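/- Let A be a hyperplane arrangement in K^n defined by squarefree product f of linear forms, char K = 0. Then the multiplicity of H^1_{(f)}(R) as a holonomic left D_n-module (with respect to the Bernstein filtration) equals π(A,1) − 1. -/

import Mathlib

open Polynomial MvPolynomial

/-- Defining relations of the `n`-th Weyl algebra over `K`:
generators `Sum.inl i` are the multiplication operators `x_i`, generators
`Sum.inr i` are the partial derivations `∂_i`. -/
inductive WeylRel (K : Type) [Field K] (n : ℕ) :
    FreeAlgebra K (Fin n ⊕ Fin n) → FreeAlgebra K (Fin n ⊕ Fin n) → Prop
  | xx (i j : Fin n) : WeylRel K n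
      (FreeAlgebra.ι K (Sum.inl i) * FreeAlgebra.ι K (Sum.inl j))
      (FreeAlgebra.ι K (Sum.inl j) * FreeAlgebra.ι K (Sum.inl i))
  | dd (i j : Fin n) : WeylRel K n
      (FreeAlgebra.ι K (Sum.inr i) * FreeAlgebra.ι K (Sum.inr j))
      (FreeAlgebra.ι K (Sum.inr j) * FreeAlgebra.ι K (Sum.inr i))
  | dx (i j : Fin n) : WeylRel K n
      (FreeAlgebra.ι K (Sum.inr i) * FreeAlgebra.ι K (Sum.inl j))
      (FreeAlgebra.ι K (Sum.inl j) * FreeAlgebra.ι K (Sum.inr i)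
        + if i = j then 1 else 0)

/-- The `n`-th Weyl algebra `D_n` over `K`. -/
abbrev Weyl (K : Type) [Field K] (n : ℕ) : Type := RingQuot (WeylRel K n)

/-- The operator `x_i ∈ D_n`. -/
noncomputable def wX (K : Type) [Field K] (n : ℕ) (i : Fin n) : Weyl K n :=
  RingQuot.mkAlgHom K (WeylRel K n) (FreeAlgebra.ι K (Sum.inl i))

/-- The operator `∂_i ∈ D_n`. -/
noncomputable def wD (K : Type) [Field K] (n : ℕ) (i : Fin n) : Weyl K n :=
  RingQuot.mkAlgHom K (WeylRel K n) (FreeAlgebra.ι K (Sum.inr i))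

/-- The Bernstein filtration on the Weyl algebra: `F_k(D_n)` is spanned by the
monomials `x^α ∂^β` with `|α| + |β| ≤ k`. -/
noncomputable def bernsteinF (K : Type) [Field K] (n : ℕ) (k : ℤ) :
    Submodule K (Weyl K n) :=
  Submodule.span K {w | ∃ α β : Fin n → ℕ,
    ((∑ i, α i : ℕ) + (∑ i, β i : ℕ) : ℤ) ≤ k ∧
    w = ((List.finRange n).map fun i => wX K n i ^ α i).prod *
        ((List.finRange n).map fun i => wD K n i ^ β i).prod}

/-- A good Bernstein filtration on a left `D_n`-module `M`. -/
structure GoodFiltration (K : Type) [Field K] (n : ℕ) (M : Type)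
    [AddCommGroup M] [Module K M] [Module (Weyl K n) M]
    [IsScalarTower K (Weyl K n) M] (F : ℤ → Submodule K M) : Prop where
  mono : ∀ k, F k ≤ F (k + 1)
  exhaustive : ∀ m : M, ∃ k, m ∈ F k
  compat : ∀ j k : ℤ, ∀ w ∈ bernsteinF K n j, ∀ m ∈ F k, w • m ∈ F (j + k)
  bddBelow : ∃ k₀ : ℤ, ∀ k < k₀, F k = ⊥
  finiteDim : ∀ k, FiniteDimensional K (F k)
  good : ∃ k₁ : ℤ, ∀ k ≥ k₁, ∀ j ≥ (0 : ℤ),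
    F (j + k) ≤ Submodule.span K
      {m | ∃ w ∈ bernsteinF K n j, ∃ v ∈ F k, m = w • v}

/-- `HasMult K n M m` : the holonomic module `M` admits a good Bernstein filtration
whose Hilbert polynomial `h` satisfies `(deg h)! · (leading coeff of h) = m`; i.e.
the multiplicity of `M` is `m`. -/
def HasMult (K : Type) [Field K] (n : ℕ) (M : Type)
    [AddCommGroup M] [Module K M] [Module (Weyl K n) M]
    [IsScalarTower K (Weyl K n) M] (m : ℚ) : Prop :=
  ∃ F : ℤ → Submodule K M, GoodFiltration K n M F ∧
    ∃ h : Polynomial ℚ,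
      (∃ N : ℤ, ∀ k ≥ N, (Module.finrank K (F k) : ℚ) = h.eval (k : ℚ)) ∧
      m = (Nat.factorial h.natDegree : ℚ) * h.leadingCoeff

/-- `M` is a holonomic left `D_n`-module. -/
def IsHolonomic (K : Type) [Field K] (n : ℕ) (M : Type)
    [AddCommGroup M] [Module K M] [Module (Weyl K n) M]
    [IsScalarTower K (Weyl K n) M] : Prop :=
  Subsingleton M ∨
  ∃ F : ℤ → Submodule K M, GoodFiltration K n M F ∧
    ∃ h : Polynomial ℚ,
      (∃ N : ℤ, ∀ k ≥ N, (Module.finrank K (F k) : ℚ) = h.eval (k : ℚ)) ∧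
      h.natDegree = n

/-- The length of a module: the Krull dimension of its lattice of submodules. -/
noncomputable def mlength (A : Type) [Ring A] (M : Type) [AddCommGroup M]
    [Module A M] : WithBot ℕ∞ :=
  Order.krullDim (Submodule A M)

section LocalCoh
variable (K : Type) [Field K] (n : ℕ)

/-- The zero set in `K^n` of a polynomial. -/
def zeroSet (p : MvPolynomial (Fin n) K) : Set (Fin n → K) :=
  {x | MvPolynomial.eval x p = 0}

/-- The property that a given `D_n`-module structure on the localization
`R[f⁻¹]` is the natural one: `x_i` acts by multiplication and `∂_i` acts as the
(unique) derivation of `R[f⁻¹]` extending `∂/∂x_i` on `R`. -/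
def NatActs (f : MvPolynomial (Fin n) K)
    [Module (Weyl K n) (Localization.Away f)] : Prop :=
  (∀ (i : Fin n) (m : Localization.Away f),
      wX K n i • m =
        algebraMap (MvPolynomial (Fin n) K) (Localization.Away f)
          (MvPolynomial.X i) * m) ∧
  (∀ i : Fin n, ∃ δ : Derivation K (Localization.Away f) (Localization.Away f),
      (∀ m, wD K n i • m = δ m) ∧
      ∀ r : MvPolynomial (Fin n) K,
        δ (algebraMap (MvPolynomial (Fin n) K) (Localization.Away f) r) =
          algebraMap (MvPolynomial (Fin n) K) (Localization.Away f)
            (MvPolynomial.pderiv i r))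

/-- The first local cohomology module `H¹_{(f)}(R) = R[f⁻¹]/R` as a left
`D_n`-module. -/
noncomputable abbrev H1 (f : MvPolynomial (Fin n) K)
    [Module (Weyl K n) (Localization.Away f)] : Type :=
  (Localization.Away f) ⧸ Submodule.span (Weyl K n)
    (Set.range (algebraMap (MvPolynomial (Fin n) K) (Localization.Away f)))

end LocalCoh

section Arrangement
open scoped Classical
variable (K : Type) [Field K] (n : ℕ)

/-- The intersection poset of an arrangement `𝒜` of hyperplanes inside the
ambient affine subspace `V0`: all nonempty intersections of subfamilies
(including the ambient space `V0` itself, as the empty intersection). -/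
noncomputable def interPoset (V0 : Set (Fin n → K))
    (𝒜 : Finset (Set (Fin n → K))) : Finset (Set (Fin n → K)) :=
  (𝒜.powerset.image fun S => V0 ∩ ⋂ H ∈ S, H).filter fun X => X ≠ ∅

/-- Codimension of `X` inside the ambient affine subspace `V0`. -/
noncomputable def codim (V0 X : Set (Fin n → K)) : ℕ :=
  Module.finrank K (vectorSpan K V0) - Module.finrank K (vectorSpan K X)

/-- `μ` is the Möbius function of the intersection poset of `𝒜` (with ambient
space `V0`), for the order `X ≤ Y ↔ X ⊇ Y`. -/
def IsMobius (V0 : Set (Fin n → K)) (𝒜 : Finset (Set (Fin n → K)))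
    (μ : Set (Fin n → K) → ℤ) : Prop :=
  μ V0 = 1 ∧
  ∀ Y ∈ interPoset K n V0 𝒜, Y ≠ V0 →
    ∑ Z ∈ (interPoset K n V0 𝒜).filter fun Z => Y ⊆ Z, μ Z = 0

/-- The Poincaré polynomial `π(𝒜,t) = ∑_{X ∈ L(𝒜)} μ(X)(−t)^{codim X}`. -/
noncomputable def poin (V0 : Set (Fin n → K)) (𝒜 : Finset (Set (Fin n → K)))
    (μ : Set (Fin n → K) → ℤ) : Polynomial ℤ :=
  ∑ X ∈ interPoset K n V0 𝒜, Polynomial.C (μ X) * (- Polynomial.X) ^ codim K n V0 X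

end Arrangement

section Nbc
open scoped Classical
variable {K V : Type*} [Field K] [AddCommGroup V] [Module K V]

/-- No vector of the family `ℓ 0, …, ℓ (r - 1)` lies in the span of the members of `S` of
larger index: `S` contains no broken circuit. -/
def NoBrokenCircuit (K : Type*) {V : Type*} [Field K] [AddCommGroup V] [Module K V]
    (ℓ : ℕ → V) (r : ℕ) (S : Finset ℕ) : Prop :=
  ∀ h < r, ℓ h ∉ Submodule.span K (ℓ '' {i | i ∈ S ∧ h < i})

/-- The sets of indices below `r` without broken circuit whose span avoids `e`. -/
noncomputable def nbcSets (K : Type*) {V : Type*} [Field K] [AddCommGroup V] [Module K V]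
    (ℓ : ℕ → V) (e : V) (r : ℕ) : Finset (Finset ℕ) :=
  (Finset.range r).powerset.filter fun S =>
    NoBrokenCircuit K ℓ r S ∧ e ∉ Submodule.span K (ℓ '' S)

theorem mem_nbcSets {ℓ : ℕ → V} {e : V} {r : ℕ} {S : Finset ℕ} :
    S ∈ nbcSets K ℓ e r ↔ S ⊆ Finset.range r ∧ NoBrokenCircuit K ℓ r S ∧
      e ∉ Submodule.span K (ℓ '' S) := by
  simp [nbcSets]

theorem nbcSets_eq_empty_of_eq_zero {ℓ : ℕ → V} {e : V} {r h : ℕ} (hr : h < r)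
    (h0 : ℓ h = 0) : nbcSets K ℓ e r = ∅ := by
  ext S
  simp only [mem_nbcSets, Finset.notMem_empty, iff_false]
  rintro ⟨-, h1, -⟩
  exact h1 h hr (h0 ▸ Submodule.zero_mem _)

theorem empty_mem_nbcSets {ℓ : ℕ → V} {e : V} {r : ℕ} (he : e ≠ 0)
    (h0 : ∀ h < r, ℓ h ≠ 0) : ∅ ∈ nbcSets K ℓ e r := by
  simp only [mem_nbcSets, NoBrokenCircuit]
  refine ⟨by simp, fun h hr => ?_, by simpa using he⟩
  simpa using h0 h hr

theorem mem_nbcSets_of_succ {ℓ : ℕ → V} {e : V} {r : ℕ} {S : Finset ℕ}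
    (hS : S ∈ nbcSets K ℓ e (r + 1)) (hr : r ∉ S) : S ∈ nbcSets K ℓ e r := by
  rw [mem_nbcSets] at *
  refine ⟨fun i hi => ?_, fun h hh => hS.2.1 h (by omega), hS.2.2⟩
  have := Finset.mem_range.1 (hS.1 hi)
  have : i ≠ r := fun h => hr (h ▸ hi)
  exact Finset.mem_range.2 (by omega)

theorem card_nbcSets_succ_le {ℓ : ℕ → V} {e : V} {r : ℕ}
    (h : e ∈ Submodule.span K {ℓ r}) :
    (nbcSets K ℓ e (r + 1)).card ≤ (nbcSets K ℓ e r).card := by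
  refine Finset.card_le_card fun S hS => mem_nbcSets_of_succ hS fun hr => ?_
  refine (mem_nbcSets.1 hS).2.2 (Submodule.span_mono ?_ h)
  rintro _ rfl
  exact ⟨r, hr, rfl⟩

/-- The projection along `y` onto the kernel of a functional `κ` with `κ y = 1`. -/
def projAlong (κ : V →ₗ[K] K) (y : V) : V →ₗ[K] V :=
  LinearMap.id - κ.smulRight y

theorem projAlong_apply (κ : V →ₗ[K] K) (y u : V) : projAlong κ y u = u - κ u • y := by
  simp [projAlong]

theorem projAlong_self {κ : V →ₗ[K] K} {y : V} (hy : κ y = 1) : projAlong κ y y = 0 := by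
  simp [projAlong_apply, hy]

theorem projAlong_mem_span_iff {κ : V →ₗ[K] K} {y : V} (hy : κ y = 1) (X : Set V) (u : V) :
    projAlong κ y u ∈ Submodule.span K (projAlong κ y '' X) ↔
      u ∈ Submodule.span K (insert y X) := by
  constructor
  · intro h
    have hX : Submodule.span K (projAlong κ y '' X) ≤ Submodule.span K (insert y X) := by
      rw [Submodule.span_le]
      rintro _ ⟨x, hx, rfl⟩
      rw [projAlong_apply]
      exact Submodule.sub_mem _ (Submodule.subset_span (by simp [hx]))
        (Submodule.smul_mem _ _ (Submodule.subset_span (by simp)))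
    have h2 := hX h
    rw [projAlong_apply] at h2
    have h3 := Submodule.add_mem _ h2
      (Submodule.smul_mem _ (κ u) (Submodule.subset_span (Set.mem_insert y X)))
    simpa using h3
  · intro h
    have h2 := Submodule.mem_map_of_mem (f := projAlong κ y) h
    rw [Submodule.map_span, Set.image_insert_eq, projAlong_self hy,
      Submodule.span_insert_zero] at h2
    exact h2

theorem card_nbcSets_succ {ℓ : ℕ → V} {e : V} {r : ℕ} {κ : V →ₗ[K] K}
    (hy : κ (ℓ r) = 1) (he : κ e = 0) :
    (nbcSets K ℓ e (r + 1)).card =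
      (nbcSets K ℓ e r).card + (nbcSets K (projAlong κ (ℓ r) ∘ ℓ) e r).card := by
  have hr0 : ℓ r ≠ 0 := fun h => by simp [h] at hy
  have hsplit : nbcSets K ℓ e (r + 1) =
      nbcSets K ℓ e r ∪ (nbcSets K (projAlong κ (ℓ r) ∘ ℓ) e r).image (insert r) := by
    ext S
    by_cases hr : r ∈ S
    · obtain ⟨T, hrT, rfl⟩ : ∃ T, r ∉ T ∧ insert r T = S :=
        ⟨S.erase r, by simp, Finset.insert_erase hr⟩
      have h1 : insert r T ∉ nbcSets K ℓ e r := fun h => by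
        have := (mem_nbcSets.1 h).1 hr
        simp at this
      have h2 : insert r T ∈ (nbcSets K (projAlong κ (ℓ r) ∘ ℓ) e r).image (insert r) ↔
          T ⊆ Finset.range r ∧ T ∈ nbcSets K (projAlong κ (ℓ r) ∘ ℓ) e r := by
        rw [Finset.mem_image]
        constructor
        · rintro ⟨T', hT', h⟩
          have hT'r : r ∉ T' := fun h => by
            have := (mem_nbcSets.1 hT').1 h
            simp at this
          have : T' = T := by
            rw [← Finset.erase_insert hT'r, h, Finset.erase_insert hrT]
          exact this ▸ ⟨(mem_nbcSets.1 hT').1, hT'⟩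
        · rintro ⟨-, h⟩
          exact ⟨T, h, rfl⟩
      rw [Finset.mem_union, h2, or_iff_right h1, mem_nbcSets, mem_nbcSets]
      have h3 : insert r T ⊆ Finset.range (r + 1) ↔ T ⊆ Finset.range r := by
        constructor
        · intro h i hi
          have h4 := Finset.mem_range.1 (h (Finset.mem_insert_of_mem hi))
          have : i ≠ r := fun h => hrT (h ▸ hi)
          exact Finset.mem_range.2 (by omega)
        · intro h i hi
          rcases Finset.mem_insert.1 hi with rfl | hi
          · simp
          · have := Finset.mem_range.1 (h hi)
            exact Finset.mem_range.2 (by omega)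
      have h4 : e ∉ Submodule.span K (ℓ '' ↑(insert r T)) ↔
          e ∉ Submodule.span K (projAlong κ (ℓ r) ∘ ℓ '' ↑T) := by
        rw [Finset.coe_insert, Set.image_insert_eq, ← projAlong_mem_span_iff hy, Set.image_comp,
          projAlong_apply _ _ e, he, zero_smul, sub_zero]
      have h5 : T ⊆ Finset.range r → (NoBrokenCircuit K ℓ (r + 1) (insert r T) ↔
          NoBrokenCircuit K (projAlong κ (ℓ r) ∘ ℓ) r T) := by
        intro hTr
        have key : ∀ h < r, ℓ h ∉ Submodule.span K (ℓ '' {i | i ∈ insert r T ∧ h < i}) ↔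
            (projAlong κ (ℓ r) ∘ ℓ) h ∉
              Submodule.span K (projAlong κ (ℓ r) ∘ ℓ '' {i | i ∈ T ∧ h < i}) := by
          intro h hh
          have : {i | i ∈ insert r T ∧ h < i} = insert r {i | i ∈ T ∧ h < i} := by
            ext i
            simp only [Finset.mem_insert, Set.mem_ofPred_eq, Set.mem_insert_iff]
            constructor
            · rintro ⟨rfl | hi, h2⟩
              · exact Or.inl rfl
              · exact Or.inr ⟨hi, h2⟩
            · rintro (rfl | ⟨hi, h2⟩)
              · exact ⟨Or.inl rfl, hh⟩
              · exact ⟨Or.inr hi, h2⟩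
          rw [this, Set.image_insert_eq, ← projAlong_mem_span_iff hy, Set.image_comp]
          rfl
        constructor
        · exact fun H h hh => (key h hh).1 (H h (by omega))
        · intro H h hh
          by_cases hhr : h < r
          · exact (key h hhr).2 (H h hhr)
          · obtain rfl : h = r := by omega
            have : {i | i ∈ insert h T ∧ h < i} = ∅ := by
              ext i
              simp only [Finset.mem_insert, Set.mem_ofPred_eq, Set.mem_empty_iff_false, iff_false]
              rintro ⟨rfl | hi, h2⟩
              · omega
              · have := Finset.mem_range.1 (hTr hi)
                omega
            rw [this]
            simpa using hr0
      rw [h3, h4]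
      refine and_congr_right fun hTr => ?_
      rw [h5 hTr]
      simp [hTr]
    · have h1 : S ∉ (nbcSets K (projAlong κ (ℓ r) ∘ ℓ) e r).image (insert r) := by
        rw [Finset.mem_image]
        rintro ⟨T, -, rfl⟩
        simp at hr
      rw [Finset.mem_union, or_iff_left h1]
      refine ⟨fun h => mem_nbcSets_of_succ h hr, fun h => ?_⟩
      rw [mem_nbcSets] at *
      refine ⟨h.1.trans (Finset.range_mono (by omega)), fun k hk => ?_, h.2.2⟩
      by_cases hkr : k < r
      · exact h.2.1 k hkr
      · have : {i | i ∈ S ∧ k < i} = ∅ := by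
          ext i
          simp only [Set.mem_ofPred_eq, Set.mem_empty_iff_false, iff_false]
          rintro ⟨hi, h2⟩
          have := Finset.mem_range.1 (h.1 hi)
          omega
        obtain rfl : k = r := by omega
        rw [this]
        simpa using hr0
  rw [hsplit, Finset.card_union_of_disjoint, Finset.card_image_of_injOn]
  · intro S hS T hT h
    have hS' : r ∉ S := fun h => by
      have := (mem_nbcSets.1 hS).1 h
      simp at this
    have hT' : r ∉ T := fun h => by
      have := (mem_nbcSets.1 hT).1 h
      simp at this
    rw [← Finset.erase_insert hS', ← Finset.erase_insert hT']
    exact congrArg (fun Z => Z.erase r) h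
  · rw [Finset.disjoint_left]
    intro S hS h
    rw [Finset.mem_image] at h
    obtain ⟨T, -, rfl⟩ := h
    have := (mem_nbcSets.1 hS).1 (Finset.mem_insert_self r T)
    simp at this

/-- Adding or removing an index. -/
def toggle (h : ℕ) (S : Finset ℕ) : Finset ℕ := if h ∈ S then S.erase h else insert h S

theorem mem_toggle_of_ne {h i : ℕ} (hi : i ≠ h) (S : Finset ℕ) : i ∈ toggle h S ↔ i ∈ S := by
  unfold toggle
  split_ifs <;> simp [hi]

theorem toggle_toggle (h : ℕ) (S : Finset ℕ) : toggle h (toggle h S) = S := by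
  by_cases hS : h ∈ S
  · simp [toggle, hS]
  · simp [toggle, hS]

theorem toggle_ne (h : ℕ) (S : Finset ℕ) : toggle h S ≠ S := by
  intro H
  have : h ∈ toggle h S ↔ h ∈ S := by rw [H]
  by_cases hS : h ∈ S <;> simp [toggle, hS] at this

theorem neg_one_pow_card_toggle (h : ℕ) (S : Finset ℕ) :
    (-1 : ℤ) ^ (toggle h S).card = - (-1) ^ S.card := by
  by_cases hS : h ∈ S
  · have := Finset.card_erase_add_one hS
    rw [← this]
    simp [toggle, hS, pow_succ]
  · simp [toggle, hS, Finset.card_insert_of_notMem, pow_succ]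

theorem span_toggle {ℓ : ℕ → V} {h : ℕ} {S : Finset ℕ}
    (hS : ℓ h ∈ Submodule.span K (ℓ '' {i | i ∈ S ∧ h < i})) (k : ℕ) (hk : k ≤ h) :
    Submodule.span K (ℓ '' {i | i ∈ toggle h S ∧ k ≤ i}) =
      Submodule.span K (ℓ '' {i | i ∈ S ∧ k ≤ i}) := by
  have aux : ∀ T T' : Finset ℕ, (∀ i, i ≠ h → (i ∈ T ↔ i ∈ T')) →
      ℓ h ∈ Submodule.span K (ℓ '' {i | i ∈ T ∧ h < i}) →
      Submodule.span K (ℓ '' {i | i ∈ T' ∧ k ≤ i}) ≤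
        Submodule.span K (ℓ '' {i | i ∈ T ∧ k ≤ i}) := by
    intro T T' hTT hT
    rw [Submodule.span_le]
    rintro _ ⟨i, ⟨hi, hki⟩, rfl⟩
    by_cases hih : i = h
    · subst hih
      refine Submodule.span_mono (Set.image_mono ?_) hT
      exact fun j hj => ⟨hj.1, by have := hj.2; omega⟩
    · exact Submodule.subset_span ⟨i, ⟨(hTT i hih).2 hi, hki⟩, rfl⟩
  refine le_antisymm (aux _ _ (fun i hi => (mem_toggle_of_ne hi S).symm) hS)
    (aux _ _ (fun i hi => mem_toggle_of_ne hi S) ?_)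
  have : {i | i ∈ toggle h S ∧ h < i} = {i | i ∈ S ∧ h < i} := by
    ext i
    exact and_congr_left fun H => mem_toggle_of_ne (by omega) S
  rwa [this]

/-- Whitney's broken circuit theorem: in an alternating sum over all sets of indices of a
quantity which only depends on the span, the sets with a broken circuit cancel. -/
theorem sum_neg_one_pow_card_eq_sum_noBrokenCircuit (ℓ : ℕ → V) (r : ℕ)
    (c : Submodule K V → ℤ) :
    ∑ S ∈ (Finset.range r).powerset, (-1 : ℤ) ^ S.card * c (Submodule.span K (ℓ '' S)) =
      ∑ S ∈ (Finset.range r).powerset.filter (NoBrokenCircuit K ℓ r),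
        (-1 : ℤ) ^ S.card * c (Submodule.span K (ℓ '' S)) := by
  rw [← Finset.sum_filter_add_sum_filter_not _ (NoBrokenCircuit K ℓ r), add_eq_left]
  let p : Finset ℕ → ℕ → Prop := fun S h =>
    h < r ∧ ℓ h ∈ Submodule.span K (ℓ '' {i | i ∈ S ∧ h < i})
  have hex : ∀ S ∈ (Finset.range r).powerset.filter (fun S => ¬ NoBrokenCircuit K ℓ r S),
      ∃ h, p S h := by
    intro S hS
    have := (Finset.mem_filter.1 hS).2
    unfold NoBrokenCircuit at this
    push Not at this
    obtain ⟨h, h1, h2⟩ := this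
    exact ⟨h, h1, h2⟩
  have hp : ∀ S h, p S h → ∀ k ≤ h, p (toggle h S) k ↔ p S k := by
    intro S h hh k hk
    refine and_congr_right fun _ => ?_
    rcases hk.eq_or_lt with rfl | hk
    · have : {i | i ∈ toggle k S ∧ k < i} = {i | i ∈ S ∧ k < i} := by
        ext i
        constructor
        · exact fun H => ⟨(mem_toggle_of_ne (by have := H.2; omega) S).1 H.1, H.2⟩
        · exact fun H => ⟨(mem_toggle_of_ne (by have := H.2; omega) S).2 H.1, H.2⟩
      rw [this]
    · have := span_toggle hh.2 (k + 1) hk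
      simp only [Nat.succ_le_iff] at this
      rw [this]
  have hspan : ∀ S h, p S h → Submodule.span K (ℓ '' (toggle h S : Finset ℕ)) =
      Submodule.span K (ℓ '' (S : Finset ℕ)) := by
    intro S h hh
    have := span_toggle hh.2 0 (Nat.zero_le _)
    simpa using this
  refine Finset.sum_involution (fun S hS => toggle (Nat.find (hex S hS)) S) ?_ ?_ ?_ ?_
  · intro S hS
    rw [hspan S _ (Nat.find_spec (hex S hS)), neg_one_pow_card_toggle]
    ring
  · intro S hS _
    exact toggle_ne _ _
  · intro S hS
    have hf := Nat.find_spec (hex S hS)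
    rw [Finset.mem_filter, Finset.mem_powerset] at *
    constructor
    · intro i hi
      by_cases hih : i = Nat.find (hex S (by rwa [Finset.mem_filter, Finset.mem_powerset]))
      · rw [hih]
        exact Finset.mem_range.2 hf.1
      · exact hS.1 ((mem_toggle_of_ne hih S).1 hi)
    · intro H
      exact H _ hf.1 ((hp S _ hf _ le_rfl).2 hf).2
  · intro S hS
    have hf := Nat.find_spec (hex S hS)
    have : ∀ hex', Nat.find (p := p (toggle (Nat.find (hex S hS)) S)) hex' =
        Nat.find (hex S hS) := by
      intro hex'
      rw [Nat.find_eq_iff]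
      refine ⟨(hp S _ hf _ le_rfl).2 hf, fun k hk => ?_⟩
      rw [hp S _ hf k hk.le]
      exact Nat.find_min _ hk
    simp only [this, toggle_toggle]

end Nbc

section Laurent
variable {K : Type*} [Field K]

theorem finrank_add_finrank_map_le_finrank_sup {B F F' : Type*} [AddCommGroup B] [Module K B]
    [AddCommGroup F] [Module K F] [AddCommGroup F'] [Module K F']
    (T : B →ₗ[K] F) (ψ : B →ₗ[K] F') (W : Submodule K B) (E : Submodule K F)
    [FiniteDimensional K E] [FiniteDimensional K (W.map T)]
    (h : ∀ x ∈ W, T x ∈ E → ψ x = 0) :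
    Module.finrank K E + Module.finrank K (W.map ψ) ≤
      Module.finrank K (E ⊔ W.map T : Submodule K F) := by
  obtain ⟨s, hs⟩ := LinearMap.exists_rightInverse_of_surjective (ψ.submoduleMap W)
    (LinearMap.range_eq_top.2 (ψ.submoduleMap_surjective W))
  let g : W.map ψ →ₗ[K] F := T ∘ₗ W.subtype ∘ₗ s
  have hψs : ∀ v, ψ (s v) = v := fun v => by
    have := congrArg Subtype.val (LinearMap.congr_fun hs v)
    simpa using this
  have hker : ∀ v, g v ∈ E → v = 0 := fun v hv => by
    have := h _ (s v).2 hv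
    rw [hψs] at this
    exact Subtype.ext this
  have hinj : Function.Injective g := by
    rw [injective_iff_map_eq_zero]
    exact fun v hv => hker v (hv ▸ E.zero_mem)
  have hrange : LinearMap.range g ≤ W.map T := by
    rintro _ ⟨v, rfl⟩
    exact ⟨s v, (s v).2, rfl⟩
  have : FiniteDimensional K (LinearMap.range g) :=
    Submodule.finiteDimensional_of_le hrange
  have hdisj : E ⊓ LinearMap.range g = ⊥ := by
    rw [eq_bot_iff]
    rintro _ ⟨hE, v, rfl⟩
    simp [hker v hE]
  have h1 := Submodule.finrank_sup_add_finrank_inf_eq E (LinearMap.range g)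
  rw [hdisj, finrank_bot, add_zero, LinearMap.finrank_range_of_inj hinj] at h1
  rw [← h1]
  exact Submodule.finrank_mono (sup_le_sup_left hrange E)

theorem finrank_add_sum_le_of_laurent {B F F' : Type*} [CommRing B] [Algebra K B] [CommRing F]
    [Algebra K F] [CommRing F'] [Algebra K F'] (ι : B →ₐ[K] F) (ψ : B →ₐ[K] F')
    (hι : Function.Injective ι) {y : B} (hψ : ψ y = 0) {t : F} (ht : t * ι y = 1)
    (W : ℕ → Submodule K B) [∀ b, FiniteDimensional K (W b)] (Z : Submodule K F)
    [FiniteDimensional K Z] (k : ℕ) (hZ : ∀ b ≤ k, ∀ x ∈ W b, t ^ b * ι x ∈ Z) :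
    Module.finrank K (W 0) +
      ∑ b ∈ Finset.range k, Module.finrank K ((W (b + 1)).map ψ.toLinearMap) ≤
      Module.finrank K Z := by
  have key : ∀ j ≤ k, ∃ Q ≤ Z, (∀ x ∈ Q, ∃ z, ι y ^ j * x = ι z) ∧
      Module.finrank K (W 0) +
        ∑ b ∈ Finset.range j, Module.finrank K ((W (b + 1)).map ψ.toLinearMap) ≤
        Module.finrank K Q := by
    intro j
    induction j with
    | zero =>
      intro _
      refine ⟨(W 0).map ι.toLinearMap, ?_, ?_, ?_⟩
      · rintro _ ⟨x, hx, rfl⟩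
        simpa using hZ 0 (Nat.zero_le _) x hx
      · rintro _ ⟨x, hx, rfl⟩
        exact ⟨x, by simp⟩
      · rw [Finset.sum_range_zero, add_zero]
        exact (Submodule.equivMapOfInjective ι.toLinearMap hι (W 0)).finrank_eq.le
    | succ j ih =>
      intro hj
      obtain ⟨Q, hQZ, hQ, hdim⟩ := ih (by omega)
      let T : B →ₗ[K] F := LinearMap.mulLeft K (t ^ (j + 1)) ∘ₗ ι.toLinearMap
      have hT : ∀ x, T x = t ^ (j + 1) * ι x := fun x => rfl
      have hyt : ∀ m, ι y ^ m * t ^ m = 1 := fun m => by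
        rw [← mul_pow, mul_comm, ht, one_pow]
      refine ⟨Q ⊔ (W (j + 1)).map T, sup_le hQZ ?_, ?_, ?_⟩
      · rintro _ ⟨x, hx, rfl⟩
        exact hZ _ hj x hx
      · intro x hx
        obtain ⟨q, hq, _, ⟨w, hw, rfl⟩, rfl⟩ := Submodule.mem_sup.1 hx
        obtain ⟨z, hz⟩ := hQ q hq
        refine ⟨y * z + w, ?_⟩
        rw [hT, mul_add, ← mul_assoc _ _ (ι w), hyt, pow_succ', mul_assoc, hz]
        simp
      · have : FiniteDimensional K Q := Submodule.finiteDimensional_of_le hQZ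
        have h1 := finrank_add_finrank_map_le_finrank_sup T ψ.toLinearMap (W (j + 1)) Q ?_
        · rw [Finset.sum_range_succ]
          omega
        · intro x _ hx
          obtain ⟨z, hz⟩ := hQ _ hx
          have h2 : ι x = ι (y * z) := by
            rw [map_mul, ← hz, hT, ← mul_assoc, ← mul_assoc, ← pow_succ', hyt, one_mul]
          rw [hι h2]
          simp [hψ]
  obtain ⟨Q, hQZ, -, hdim⟩ := key k le_rfl
  exact hdim.trans (Submodule.finrank_mono hQZ)

end Laurent

section AffineForms
variable {K : Type*} [Field K] {n : ℕ}

/-- The space of polynomials of degree at most one. -/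
noncomputable abbrev affineForms (K : Type*) [Field K] (n : ℕ) :
    Submodule K (MvPolynomial (Fin n) K) :=
  restrictTotalDegree (Fin n) K 1

theorem eq_of_mem_affineForms {u : MvPolynomial (Fin n) K} (hu : u ∈ affineForms K n) :
    u = MvPolynomial.C (MvPolynomial.coeff 0 u) +
      ∑ i, MvPolynomial.C (MvPolynomial.coeff (Finsupp.single i 1) u) * MvPolynomial.X i := by
  classical
  have hd : u.totalDegree ≤ 1 := (mem_restrictTotalDegree _ _ _).1 hu
  ext m
  simp only [MvPolynomial.coeff_add, MvPolynomial.coeff_C, MvPolynomial.coeff_sum,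
    MvPolynomial.coeff_C_mul, MvPolynomial.coeff_X]
  by_cases hm : m = 0
  · subst hm
    simp [Finsupp.single_eq_zero]
  rw [if_neg (Ne.symm hm), zero_add]
  by_cases h1 : ∃ i, m = Finsupp.single i 1
  · obtain ⟨i, rfl⟩ := h1
    simp [Finsupp.single_left_inj]
  · push Not at h1
    rw [Finset.sum_eq_zero fun i _ => by simp [(h1 i).symm]]
    refine coeff_eq_zero_of_totalDegree_lt (hd.trans_lt ?_)
    obtain ⟨i, hi⟩ := Finsupp.ne_iff.1 hm
    rw [Finsupp.coe_zero, Pi.zero_apply] at hi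
    by_contra hlt
    push Not at hlt
    apply h1 i
    have hsum : ∑ j, m j ≤ 1 := by
      refine le_trans (le_of_eq ?_) hlt
      exact (Finsupp.sum_fintype m (fun _ e => e) (by simp)).symm
    rw [← Finset.add_sum_erase _ _ (Finset.mem_univ i)] at hsum
    ext j
    by_cases hij : j = i
    · subst hij
      simp
      omega
    · have := Finset.single_le_sum (f := m) (fun _ _ => Nat.zero_le _)
        (Finset.mem_erase.2 ⟨hij, Finset.mem_univ j⟩)
      rw [Finsupp.single_eq_of_ne hij]
      omega

theorem one_mem_affineForms : (1 : MvPolynomial (Fin n) K) ∈ affineForms K n := by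
  simp [mem_restrictTotalDegree]

/-- The functional sending a polynomial to its coefficient at `X j`, normalized by the factor
`c⁻¹`. -/
noncomputable def linCoeff (j : Fin n) (c : K) : MvPolynomial (Fin n) K →ₗ[K] K :=
  c⁻¹ • lcoeff K (Finsupp.single j 1)

theorem linCoeff_apply (j : Fin n) (c : K) (u : MvPolynomial (Fin n) K) :
    linCoeff j c u = c⁻¹ * MvPolynomial.coeff (Finsupp.single j 1) u := rfl

theorem linCoeff_one (j : Fin n) (c : K) : linCoeff j c 1 = 0 := by
  classical
  rw [linCoeff_apply, MvPolynomial.coeff_one,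
    if_neg (by simp [eq_comm, Finsupp.single_eq_zero]), mul_zero]

/-- The substitution restricting polynomials to the hyperplane `y = 0`, where the coefficient `c`
of `X j` in `y` is used to eliminate `X j`. -/
noncomputable def restrictHyperplane (j : Fin n) (c : K) (y : MvPolynomial (Fin n) K) :
    MvPolynomial (Fin n) K →ₐ[K] MvPolynomial (Fin n) K :=
  aeval fun i => projAlong (linCoeff j c) y (MvPolynomial.X i)

theorem restrictHyperplane_apply (j : Fin n) (c : K) (y : MvPolynomial (Fin n) K)
    {u : MvPolynomial (Fin n) K} (hu : u ∈ affineForms K n) :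
    restrictHyperplane j c y u = projAlong (linCoeff j c) y u := by
  rw [eq_of_mem_affineForms hu]
  have h1 : ∀ a : K, (MvPolynomial.C a : MvPolynomial (Fin n) K) = a • 1 := fun a => by
    rw [MvPolynomial.smul_eq_C_mul, mul_one]
  simp only [map_add, map_sum, MvPolynomial.C_mul', map_smul]
  rw [h1, map_smul, map_smul, map_one, projAlong_apply _ _ 1, linCoeff_one, zero_smul, sub_zero]
  simp [restrictHyperplane]

theorem exists_coeff_ne_zero {u : MvPolynomial (Fin n) K} (hu : u ∈ affineForms K n)
    (h : u ∉ Submodule.span K {1}) : ∃ j, MvPolynomial.coeff (Finsupp.single j 1) u ≠ 0 := by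
  by_contra hcon
  push Not at hcon
  apply h
  rw [eq_of_mem_affineForms hu, Submodule.mem_span_singleton]
  exact ⟨MvPolynomial.coeff 0 u, by simp [hcon, MvPolynomial.smul_eq_C_mul]⟩

section
variable {U : Submodule K (MvPolynomial (Fin n) K)} {y : MvPolynomial (Fin n) K} {j : Fin n}

theorem map_restrictHyperplane_le (hU : U ≤ affineForms K n) (hy : y ∈ U) (c : K) :
    U.map (restrictHyperplane j c y).toLinearMap ≤ U := by
  rintro _ ⟨u, hu, rfl⟩
  rw [AlgHom.toLinearMap_apply, restrictHyperplane_apply _ _ _ (hU hu), projAlong_apply]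
  exact U.sub_mem hu (U.smul_mem _ hy)

theorem linCoeff_self (hc : MvPolynomial.coeff (Finsupp.single j 1) y ≠ 0) :
    linCoeff j (MvPolynomial.coeff (Finsupp.single j 1) y) y = 1 := by
  rw [linCoeff_apply, inv_mul_cancel₀ hc]

theorem restrictHyperplane_self (hy : y ∈ affineForms K n)
    (hc : MvPolynomial.coeff (Finsupp.single j 1) y ≠ 0) :
    restrictHyperplane j (MvPolynomial.coeff (Finsupp.single j 1) y) y y = 0 := by
  rw [restrictHyperplane_apply _ _ _ hy, projAlong_self (linCoeff_self hc)]

theorem finrank_map_restrictHyperplane (hU : U ≤ affineForms K n) (hy : y ∈ U)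
    (hc : MvPolynomial.coeff (Finsupp.single j 1) y ≠ 0) :
    Module.finrank K
      (U.map (restrictHyperplane j (MvPolynomial.coeff (Finsupp.single j 1) y) y).toLinearMap) + 1 =
      Module.finrank K U := by
  have : FiniteDimensional K U := Submodule.finiteDimensional_of_le hU
  set φ := (restrictHyperplane j (MvPolynomial.coeff (Finsupp.single j 1) y) y).toLinearMap with hφ
  have h1 := LinearMap.finrank_range_add_finrank_ker (φ.domRestrict U)
  rw [LinearMap.range_domRestrict] at h1
  rw [← h1]
  congr 1
  have hker : LinearMap.ker (φ.domRestrict U) = Submodule.span K {⟨y, hy⟩} := by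
    ext u
    rw [LinearMap.mem_ker, LinearMap.domRestrict_apply, hφ, AlgHom.toLinearMap_apply,
      restrictHyperplane_apply _ _ _ (hU u.2), projAlong_apply, Submodule.mem_span_singleton]
    constructor
    · intro h
      exact ⟨_, Subtype.ext (sub_eq_zero.1 h).symm⟩
    · rintro ⟨a, rfl⟩
      simp [linCoeff_self hc]
  rw [hker, finrank_span_singleton]
  intro h
  have : y = 0 := congrArg Subtype.val h
  simp [this] at hc

end

theorem exists_notMem_span_one {U : Submodule K (MvPolynomial (Fin n) K)} {d : ℕ}
    (hd : Module.finrank K U = d + 2) : ∃ y ∈ U, y ∉ Submodule.span K {1} := by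
  by_contra hcon
  push Not at hcon
  have h1 : Module.finrank K U ≤ Module.finrank K
      (Submodule.span K {(1 : MvPolynomial (Fin n) K)}) := Submodule.finrank_mono hcon
  have h2 := finrank_span_le_card (R := K) ({1} : Set (MvPolynomial (Fin n) K))
  simp at h2
  omega

theorem sum_range_choose_add (k d : ℕ) :
    ∑ b ∈ Finset.range (k + 1), (b + d).choose d = (k + (d + 1)).choose (d + 1) := by
  rw [Nat.sum_range_add_choose, add_assoc]

variable (K n) in
/-- The inclusion of the polynomial ring into the field of rational functions. -/
noncomputable abbrev toRat :
    MvPolynomial (Fin n) K →ₐ[K] FractionRing (MvPolynomial (Fin n) K) :=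
  IsScalarTower.toAlgHom K _ _

theorem toRat_injective : Function.Injective (toRat K n) :=
  IsFractionRing.injective (MvPolynomial (Fin n) K) (FractionRing (MvPolynomial (Fin n) K))

theorem finiteDimensional_pow {A : Type*} [CommRing A] [Algebra K A] (U : Submodule K A)
    [h : FiniteDimensional K U] (k : ℕ) : FiniteDimensional K (U ^ k : Submodule K A) :=
  Module.Finite.iff_fg.2 ((Module.Finite.iff_fg.1 h).pow k)

theorem finiteDimensional_map_affineForms {A : Type*} [CommRing A] [Algebra K A]
    {U : Submodule K (MvPolynomial (Fin n) K)} (hU : U ≤ affineForms K n)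
    (χ : MvPolynomial (Fin n) K →ₗ[K] A) : FiniteDimensional K (U.map χ) := by
  have : FiniteDimensional K U := Submodule.finiteDimensional_of_le hU
  infer_instance

theorem one_le_finrank_of_ne_zero {A : Type*} [AddCommGroup A] [Module K A] (P : Submodule K A)
    [FiniteDimensional K P] {x : A} (hx : x ∈ P) (h0 : x ≠ 0) : 1 ≤ Module.finrank K P := by
  have : Nontrivial P := ⟨⟨x, hx⟩, 0, fun h => h0 (congrArg Subtype.val h)⟩
  exact Module.finrank_pos

theorem choose_le_finrank_pow (d : ℕ) (U : Submodule K (MvPolynomial (Fin n) K))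
    (hU : U ≤ affineForms K n) (h1 : 1 ∈ U) (hd : Module.finrank K U = d + 1) (k : ℕ) :
    (k + d).choose d ≤ Module.finrank K (U.map (toRat K n).toLinearMap ^ k : Submodule K _) := by
  have hfd : ∀ {U : Submodule K (MvPolynomial (Fin n) K)}, U ≤ affineForms K n → ∀ k,
      FiniteDimensional K (U.map (toRat K n).toLinearMap ^ k : Submodule K _) := fun hU k =>
    have := finiteDimensional_map_affineForms hU (toRat K n).toLinearMap
    finiteDimensional_pow _ k
  induction d generalizing U k with
  | zero =>
    have := hfd hU k
    rw [Nat.choose_zero_right]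
    refine one_le_finrank_of_ne_zero _ (x := 1) ?_ one_ne_zero
    have := Submodule.pow_mem_pow _ (Submodule.mem_map_of_mem (f := (toRat K n).toLinearMap) h1) k
    simpa using this
  | succ d ih =>
    obtain ⟨y, hy, hy1⟩ := exists_notMem_span_one hd
    obtain ⟨j, hc⟩ := exists_coeff_ne_zero (hU hy) hy1
    have hy0 : toRat K n y ≠ 0 := fun h => by
      have : y = 0 := toRat_injective (by rw [h, map_zero])
      simp [this] at hc
    set φ := restrictHyperplane j (MvPolynomial.coeff (Finsupp.single j 1) y) y with hφ
    set t := (toRat K n y)⁻¹ with ht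
    have hfU : FiniteDimensional K U := Submodule.finiteDimensional_of_le hU
    have hW : ∀ b, FiniteDimensional K (U ^ b : Submodule K _) := fun b => finiteDimensional_pow U b
    have := hfd hU k
    have hZ := finrank_add_sum_le_of_laurent (toRat K n) ((toRat K n).comp φ) toRat_injective
      (y := y) (by simp [hφ, restrictHyperplane_self (hU hy) hc])
      (inv_mul_cancel₀ hy0) (fun b => U ^ b)
      ((U.map (toRat K n).toLinearMap ^ k).map (LinearMap.mulLeft K (t ^ k))) k ?_
    · have hinj : Function.Injective (LinearMap.mulLeft K (t ^ k)) := fun a b hab =>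
        mul_left_cancel₀ (pow_ne_zero k (inv_ne_zero hy0)) hab
      rw [← (Submodule.equivMapOfInjective _ hinj _).finrank_eq] at hZ
      refine le_trans ?_ hZ
      have h0 : 1 ≤ Module.finrank K (U ^ 0 : Submodule K _) :=
        one_le_finrank_of_ne_zero _ (x := 1)
          (by rw [pow_zero]; exact Submodule.one_le.1 le_rfl) one_ne_zero
      rw [← sum_range_choose_add, Finset.sum_range_succ', zero_add, Nat.choose_self, add_comm]
      refine add_le_add h0 (Finset.sum_le_sum fun b _ => ?_)
      have h2 := ih (U.map φ.toLinearMap) ((map_restrictHyperplane_le hU hy _).trans hU)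
        ⟨1, h1, by simp⟩ (by
          have := finrank_map_restrictHyperplane hU hy hc
          rw [← hφ] at this
          omega) (b + 1)
      rw [← Submodule.map_comp, ← AlgHom.comp_toLinearMap, ← Submodule.map_pow] at h2
      exact h2
    · intro b hb x hx
      refine ⟨toRat K n (y ^ (k - b) * x), ?_, ?_⟩
      · rw [← Submodule.map_pow]
        refine Submodule.mem_map_of_mem (f := (toRat K n).toLinearMap) ?_
        have := Submodule.mul_mem_mul (Submodule.pow_mem_pow U hy (k - b)) hx
        rwa [← pow_add, Nat.sub_add_cancel hb] at this
      · obtain ⟨c, rfl⟩ := Nat.exists_eq_add_of_le hb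
        rw [LinearMap.mulLeft_apply, map_mul, map_pow, add_comm b c, pow_add, Nat.add_sub_cancel,
          ← mul_assoc, mul_comm (t ^ c), mul_assoc (t ^ b), ← mul_pow, ht, inv_mul_cancel₀ hy0,
          one_pow, mul_one]

/-- The `k`-th step of the filtration of an algebra by total order: it is spanned by the products
of `k` factors which lie in `U` or are among `t 0, …, t (r - 1)`. -/
noncomputable def poleFilt {A : Type*} [CommRing A] [Algebra K A] (U : Submodule K A) (t : ℕ → A)
    (r k : ℕ) : Submodule K A :=
  (U ⊔ Submodule.span K (t '' Set.Iio r)) ^ k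

section
variable {A A' : Type*} [CommRing A] [Algebra K A] [CommRing A'] [Algebra K A']

theorem map_poleFilt (χ : A →ₐ[K] A') (U : Submodule K A) (t : ℕ → A) (r k : ℕ) :
    (poleFilt U t r k).map χ.toLinearMap =
      poleFilt (U.map χ.toLinearMap) (χ ∘ t) r k := by
  rw [poleFilt, Submodule.map_pow, Submodule.map_sup, Submodule.map_span, poleFilt,
    Set.image_comp]
  rfl

theorem poleFilt_mono_left (U : Submodule K A) (t : ℕ → A) (k : ℕ) {r s : ℕ} (h : r ≤ s) :
    poleFilt U t r k ≤ poleFilt U t s k :=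
  pow_le_pow_left' (sup_le_sup_left
    (Submodule.span_mono (Set.image_mono (Set.Iio_subset_Iio h))) _) k

theorem finiteDimensional_poleFilt (U : Submodule K A) [FiniteDimensional K U] (t : ℕ → A)
    (r k : ℕ) : FiniteDimensional K (poleFilt U t r k) := by
  have : FiniteDimensional K (Submodule.span K (t '' Set.Iio r)) :=
    FiniteDimensional.span_of_finite K ((Set.finite_Iio r).image t)
  exact finiteDimensional_pow _ k

theorem poleFilt_congr (U : Submodule K A) {t t' : ℕ → A} {r : ℕ} (h : ∀ i < r, t i = t' i)
    (k : ℕ) : poleFilt U t r k = poleFilt U t' r k := by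
  have : t '' Set.Iio r = t' '' Set.Iio r := Set.image_congr fun i hi => h i hi
  rw [poleFilt, poleFilt, this]

end

open scoped Classical in
theorem card_nbcSets_mul_choose_le_finrank_poleFilt (r : ℕ) (d : ℕ)
    (U : Submodule K (MvPolynomial (Fin n) K)) (hU : U ≤ affineForms K n) (h1 : 1 ∈ U)
    (hd : Module.finrank K U = d + 1) (ℓ : ℕ → MvPolynomial (Fin n) K) (hℓ : ∀ i < r, ℓ i ∈ U)
    (k : ℕ) (hk : r ≤ k) :
    (nbcSets K ℓ 1 r).card * (k - r + d).choose d ≤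
      Module.finrank K (poleFilt (U.map (toRat K n).toLinearMap)
        (fun i => (toRat K n (ℓ i))⁻¹) r k) := by
  induction r generalizing d U ℓ k with
  | zero =>
    have hcard : (nbcSets K ℓ 1 0).card ≤ 1 := (Finset.card_filter_le _ _).trans (by simp)
    have h2 := choose_le_finrank_pow d U hU h1 hd k
    have h3 : poleFilt (U.map (toRat K n).toLinearMap) (fun i => (toRat K n (ℓ i))⁻¹) 0 k =
        U.map (toRat K n).toLinearMap ^ k := by
      simp [poleFilt]
    rw [h3, Nat.sub_zero]
    calc _ ≤ 1 * (k + d).choose d := Nat.mul_le_mul_right _ hcard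
      _ ≤ _ := by rwa [one_mul]
  | succ r ih =>
    by_cases hz : ∃ h < r + 1, ℓ h = 0
    · obtain ⟨h, hr, h0⟩ := hz
      simp [nbcSets_eq_empty_of_eq_zero hr h0]
    push Not at hz
    have hUfd := finiteDimensional_map_affineForms hU (toRat K n).toLinearMap
    have hfd := finiteDimensional_poleFilt (U.map (toRat K n).toLinearMap)
      (fun i => (toRat K n (ℓ i))⁻¹) (r + 1) k
    have hle : (nbcSets K ℓ 1 r).card * (k - r + d).choose d ≤ _ :=
      (ih d U hU h1 hd ℓ (fun i hi => hℓ i (by omega)) k (by omega))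
    by_cases hy1 : ℓ r ∈ Submodule.span K {(1 : MvPolynomial (Fin n) K)}
    · have h1y : (1 : MvPolynomial (Fin n) K) ∈ Submodule.span K {ℓ r} := by
        obtain ⟨a, ha⟩ := Submodule.mem_span_singleton.1 hy1
        have ha0 : a ≠ 0 := fun h => hz r (by omega) (by rw [← ha, h, zero_smul])
        exact Submodule.mem_span_singleton.2 ⟨a⁻¹, by rw [← ha, smul_smul, inv_mul_cancel₀ ha0,
          one_smul]⟩
      calc _ ≤ (nbcSets K ℓ 1 r).card * (k - r + d).choose d :=
            Nat.mul_le_mul (card_nbcSets_succ_le h1y) (Nat.choose_le_choose _ (by omega))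
        _ ≤ _ := hle
        _ ≤ _ := Submodule.finrank_mono (poleFilt_mono_left _ _ _ (by omega))
    obtain ⟨j, hc⟩ := exists_coeff_ne_zero (hU (hℓ r (by omega))) hy1
    rw [card_nbcSets_succ (linCoeff_self hc) (linCoeff_one j _)]
    set y := ℓ r with hy
    have hyU : y ∈ U := hℓ r (by omega)
    set φ := restrictHyperplane j (MvPolynomial.coeff (Finsupp.single j 1) y) y with hφ
    set ℓ' := projAlong (linCoeff j (MvPolynomial.coeff (Finsupp.single j 1) y)) y ∘ ℓ with hℓ'
    have hφℓ : ∀ i < r, φ (ℓ i) = ℓ' i := fun i hi =>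
      restrictHyperplane_apply _ _ _ (hU (hℓ i (by omega)))
    by_cases hz' : ∃ h < r, ℓ' h = 0
    · obtain ⟨h, hr, h0⟩ := hz'
      rw [nbcSets_eq_empty_of_eq_zero hr h0, Finset.card_empty, add_zero]
      calc _ ≤ (nbcSets K ℓ 1 r).card * (k - r + d).choose d :=
            Nat.mul_le_mul_left _ (Nat.choose_le_choose _ (by omega))
        _ ≤ _ := hle
        _ ≤ _ := Submodule.finrank_mono (poleFilt_mono_left _ _ _ (by omega))
    push Not at hz'
    obtain ⟨d, rfl⟩ : ∃ d', d = d' + 1 := by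
      rcases d with _ | d
      · exfalso
        have h2 := finrank_map_restrictHyperplane hU hyU hc
        have : FiniteDimensional K U := Submodule.finiteDimensional_of_le hU
        have h3 := one_le_finrank_of_ne_zero (U.map φ.toLinearMap) (x := 1) ⟨1, h1, by simp⟩
          one_ne_zero
        rw [← hφ] at h2
        omega
      · exact ⟨d, rfl⟩
    set g := ∏ i ∈ Finset.range r, ℓ i with hg
    have hunit : ∀ χ : MvPolynomial (Fin n) K →ₐ[K] FractionRing (MvPolynomial (Fin n) K),
        (∀ i < r, χ (ℓ i) ≠ 0) → ∀ z : Submonoid.powers g, IsUnit (χ z) := by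
      rintro χ hχ ⟨_, e, rfl⟩
      rw [map_pow, hg, map_prod]
      refine IsUnit.pow _ (isUnit_iff_ne_zero.2 (Finset.prod_ne_zero_iff.2 fun i hi => ?_))
      exact hχ i (Finset.mem_range.1 hi)
    have hne : ∀ {u : MvPolynomial (Fin n) K}, u ≠ 0 → toRat K n u ≠ 0 := fun hu h =>
      hu (toRat_injective (by rw [h, map_zero]))
    have hχ1 : ∀ i < r, toRat K n (ℓ i) ≠ 0 := fun i hi => hne (hz i (by omega))
    have hχ2 : ∀ i < r, ((toRat K n).comp φ) (ℓ i) ≠ 0 := fun i hi => by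
      rw [AlgHom.comp_apply, hφℓ i hi]
      exact hne (hz' i hi)
    let B := Localization.Away g
    let ι : B →ₐ[K] FractionRing (MvPolynomial (Fin n) K) :=
      IsLocalization.liftAlgHom (M := Submonoid.powers g) (hunit _ hχ1)
    let ψ : B →ₐ[K] FractionRing (MvPolynomial (Fin n) K) :=
      IsLocalization.liftAlgHom (M := Submonoid.powers g) (hunit _ hχ2)
    let inc : MvPolynomial (Fin n) K →ₐ[K] B := IsScalarTower.toAlgHom K _ _
    have hιinc : ∀ u, ι (inc u) = toRat K n u := fun u => IsLocalization.lift_eq _ u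
    have hψinc : ∀ u, ψ (inc u) = toRat K n (φ u) := fun u => IsLocalization.lift_eq _ u
    have hι : Function.Injective ι := by
      have hg0 : g ≠ 0 := Finset.prod_ne_zero_iff.2 fun i hi =>
        hz i (by have := Finset.mem_range.1 hi; omega)
      refine (IsLocalization.lift_injective_iff _).2 fun a b => ⟨fun hab => ?_, fun hab => ?_⟩
      · rw [IsLocalization.injective B (powers_le_nonZeroDivisors_of_noZeroDivisors hg0) hab]
      · rw [toRat_injective hab]
    have hunitB : ∀ i < r, IsUnit (inc (ℓ i)) := fun i hi =>
      isUnit_of_dvd_unit (map_dvd inc (Finset.dvd_prod_of_mem ℓ (Finset.mem_range.2 hi)))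
        (IsLocalization.Away.algebraMap_isUnit g)
    let tB : ℕ → B := fun i => Ring.inverse (inc (ℓ i))
    have htB : ∀ (χ : B →ₐ[K] FractionRing (MvPolynomial (Fin n) K)), ∀ i < r,
        χ (tB i) = (χ (inc (ℓ i)))⁻¹ := fun χ i hi => by
      refine eq_inv_of_mul_eq_one_left ?_
      rw [← map_mul, Ring.inverse_mul_cancel _ (hunitB i hi), map_one]
    have hmap : ∀ (χ : B →ₐ[K] FractionRing (MvPolynomial (Fin n) K)) (m : ℕ),
        (poleFilt (U.map inc.toLinearMap) tB r m).map χ.toLinearMap =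
          poleFilt (U.map (χ.comp inc).toLinearMap) (fun i => (χ (inc (ℓ i)))⁻¹) r m :=
      fun χ m => by
        rw [map_poleFilt, ← Submodule.map_comp, ← AlgHom.comp_toLinearMap]
        exact poleFilt_congr _ (fun i hi => htB χ i hi) m
    have hιc : ι.comp inc = toRat K n := AlgHom.ext hιinc
    have hψc : ψ.comp inc = (toRat K n).comp φ := AlgHom.ext hψinc
    have hmapι : ∀ m, (poleFilt (U.map inc.toLinearMap) tB r m).map ι.toLinearMap =
        poleFilt (U.map (toRat K n).toLinearMap) (fun i => (toRat K n (ℓ i))⁻¹) r m := fun m => by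
      rw [hmap, hιc]
      exact poleFilt_congr _ (fun i _ => by rw [hιinc]) m
    have hUB := finiteDimensional_map_affineForms hU inc.toLinearMap
    have hWfd : ∀ b, FiniteDimensional K (poleFilt (U.map inc.toLinearMap) tB r (k - b)) :=
      fun b => finiteDimensional_poleFilt _ _ _ _
    have hfin := finrank_add_sum_le_of_laurent ι ψ hι (y := inc y)
      (by rw [hψinc, hφ, restrictHyperplane_self (hU hyU) hc, map_zero])
      (t := (toRat K n y)⁻¹)
      (by rw [hιinc, inv_mul_cancel₀ (hne (hz r (by omega)))])
      (fun b => poleFilt (U.map inc.toLinearMap) tB r (k - b))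
      (poleFilt (U.map (toRat K n).toLinearMap) (fun i => (toRat K n (ℓ i))⁻¹) (r + 1) k)
      (k - r) ?_
    · refine le_trans ?_ hfin
      rw [add_mul]
      refine add_le_add ?_ ?_
      · rw [(Submodule.equivMapOfInjective ι.toLinearMap hι _).finrank_eq, hmapι, Nat.sub_zero]
        exact le_trans (Nat.mul_le_mul_left _ (Nat.choose_le_choose _ (by omega))) hle
      · obtain ⟨m, rfl⟩ : ∃ m, k = m + 1 + r := ⟨k - r - 1, by omega⟩
        rw [show m + 1 + r - (r + 1) = m by omega, ← sum_range_choose_add,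
          ← Finset.sum_range_reflect, Finset.mul_sum, show m + 1 + r - r = m + 1 by omega]
        refine Finset.sum_le_sum fun b hb => ?_
        have hb' := Finset.mem_range.1 hb
        rw [hmap, hψc]
        have hUφ := map_restrictHyperplane_le (j := j) hU hyU
          (MvPolynomial.coeff (Finsupp.single j 1) y)
        have h2 := ih d (U.map φ.toLinearMap) (hUφ.trans hU) ⟨1, h1, by simp⟩
          (by
            have := finrank_map_restrictHyperplane hU hyU hc
            rw [← hφ] at this
            omega)
          ℓ' (fun i hi => ⟨ℓ i, hℓ i (by omega), hφℓ i hi⟩) (m + 1 + r - (b + 1)) (by omega)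
        rw [← Submodule.map_comp, ← AlgHom.comp_toLinearMap] at h2
        rw [show m + 1 + r - (b + 1) - r = m + 1 - 1 - b by omega] at h2
        refine h2.trans (le_of_eq ?_)
        have h3 := poleFilt_congr (U.map ((toRat K n).comp φ).toLinearMap)
          (t := fun i => (toRat K n (ℓ' i))⁻¹) (t' := fun i => (ψ (inc (ℓ i)))⁻¹)
          (fun i (hi : i < r) => by rw [hψinc, hφℓ i hi]) (m + 1 + r - (b + 1))
        rw [h3]
    · intro b hb x hx
      have hιx : ι x ∈ poleFilt (U.map (toRat K n).toLinearMap)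
          (fun i => (toRat K n (ℓ i))⁻¹) (r + 1) (k - b) := by
        refine poleFilt_mono_left _ _ _ (Nat.le_succ r) ?_
        have := Submodule.mem_map_of_mem (f := ι.toLinearMap) hx
        rwa [hmapι] at this
      have ht : (toRat K n y)⁻¹ ∈ U.map (toRat K n).toLinearMap ⊔
          Submodule.span K ((fun i => (toRat K n (ℓ i))⁻¹) '' Set.Iio (r + 1)) :=
        Submodule.mem_sup_right (Submodule.subset_span ⟨r, Set.mem_Iio.2 (Nat.lt_succ_self r), rfl⟩)
      have := Submodule.mul_mem_mul (Submodule.pow_mem_pow _ ht b) hιx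
      rwa [poleFilt, ← pow_add, Nat.add_sub_cancel' (by omega)] at this

end AffineForms

section Straightening
variable {K V C : Type*} [Field K] [AddCommGroup V] [Module K V] [CommRing C] [Algebra K C]

theorem le_pow_sup_mul_pow {U E Q : Submodule K C} (hE : E ≤ U) (h : U ≤ E ⊔ Q) (b : ℕ) :
    U ^ (b + 1) ≤ E ^ (b + 1) ⊔ Q * U ^ b := by
  induction b with
  | zero => simpa using h
  | succ b ih =>
    calc U ^ (b + 1 + 1) = U * U ^ (b + 1) := pow_succ' _ _
      _ ≤ (E ⊔ Q) * U ^ (b + 1) := mul_le_mul' h le_rfl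
      _ = E * U ^ (b + 1) ⊔ Q * U ^ (b + 1) := Submodule.sup_mul _ _ _
      _ ≤ E * (E ^ (b + 1) ⊔ Q * U ^ b) ⊔ Q * U ^ (b + 1) :=
          sup_le_sup_right (mul_le_mul' le_rfl ih) _
      _ ≤ _ := by
        rw [Submodule.mul_sup, ← pow_succ']
        refine sup_le (sup_le le_sup_left (le_sup_of_le_right ?_)) le_sup_right
        calc E * (Q * U ^ b) ≤ U * (Q * U ^ b) := mul_le_mul' hE le_rfl
          _ = Q * U ^ (b + 1) := by rw [mul_left_comm, ← pow_succ']

variable {lam : V →ₗ[K] C} {e : V} {ℓ : ℕ → V} {t : ℕ → C} {r : ℕ}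

theorem map_mul_prod_mul_mem {s : Multiset ℕ} (hs : ∀ i ∈ s, t i * lam (ℓ i) = 1) {T : Set ℕ}
    (hT : ∀ i ∈ T, i ∈ s) {G : Submodule K C} {x : C}
    (h : ∀ i ∈ T, ((s.erase i).map t).prod * x ∈ G) {v : V}
    (hv : v ∈ Submodule.span K (ℓ '' T)) : lam v * ((s.map t).prod * x) ∈ G := by
  induction hv using Submodule.span_induction with
  | mem v hv =>
    obtain ⟨i, hi, rfl⟩ := hv
    have h1 : (s.map t).prod = t i * ((s.erase i).map t).prod := by
      rw [← Multiset.prod_cons, ← Multiset.map_cons, Multiset.cons_erase (hT i hi)]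
    have h2 : lam (ℓ i) * ((s.map t).prod * x) =
        t i * lam (ℓ i) * (((s.erase i).map t).prod * x) := by
      rw [h1]; ring
    rw [h2, hs i (hT i hi), one_mul]
    exact h i hi
  | zero => simp
  | add v w _ _ hv hw => rw [map_add, add_mul]; exact G.add_mem hv hw
  | smul a v _ hv => rw [map_smul, smul_mul_assoc]; exact G.smul_mem a hv

theorem prod_mul_mem_of_nbcSets (hlam : lam e = 1) (ht : ∀ i < r, t i * lam (ℓ i) = 1)
    {U : Submodule K V} {G : ℕ → Submodule K C} (hG : Monotone G) {E : Finset ℕ → Submodule K V}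
    (hEU : ∀ S ∈ nbcSets K ℓ e r, E S ≤ U)
    (hE : ∀ S ∈ nbcSets K ℓ e r, U ≤ E S ⊔ (Submodule.span K {e} ⊔ Submodule.span K (ℓ '' S)))
    (hbase : ∀ s : Multiset ℕ, s.toFinset ∈ nbcSets K ℓ e r → ∀ b,
      ∀ x ∈ (E s.toFinset).map lam ^ b, (s.map t).prod * x ∈ G (s.card + b))
    (s : Multiset ℕ) (hs : ∀ i ∈ s, i < r) (b : ℕ) {x : C} (hx : x ∈ U.map lam ^ b) :
    (s.map t).prod * x ∈ G (s.card + b) := by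
  induction hN : s.card + b using Nat.strong_induction_on generalizing s b x with
  | _ N ihN =>
  induction hw : s.sum using Nat.strong_induction_on generalizing s with
  | _ w ihw =>
  have hts : ∀ i ∈ s, t i * lam (ℓ i) = 1 := fun i hi => ht i (hs i hi)
  have herase : ∀ {i : ℕ}, i ∈ s → (s.erase i).card + 1 = s.card := fun hi =>
    Multiset.card_erase_add_one hi
  by_cases h1 : e ∈ Submodule.span K (ℓ '' s.toFinset)
  · have := map_mul_prod_mul_mem (T := s.toFinset) (G := G N) (x := x) hts (by simp)
      (fun i hi => ?_)
      h1
    · rwa [hlam, one_mul] at this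
    · have hi' : i ∈ s := by simpa using hi
      have hc := herase hi'
      exact hG (by omega) (ihN ((s.erase i).card + b) (by omega) _
        (fun j hj => hs j (Multiset.mem_of_mem_erase hj)) b hx rfl)
  by_cases h2 : NoBrokenCircuit K ℓ r s.toFinset
  · have hmem : s.toFinset ∈ nbcSets K ℓ e r :=
      mem_nbcSets.2 ⟨fun i hi => Finset.mem_range.2 (hs i (by simpa using hi)), h2, h1⟩
    rcases b with _ | b
    · rw [← hN]
      exact hbase s hmem 0 x (by simpa using hx)
    set Q := Submodule.span K {e} ⊔ Submodule.span K (ℓ '' s.toFinset) with hQ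
    have hle := le_pow_sup_mul_pow (U := U.map lam) (E := (E s.toFinset).map lam)
      (Q := Q.map lam) (Submodule.map_mono (hEU _ hmem))
      (by rw [← Submodule.map_sup]; exact Submodule.map_mono (hE _ hmem)) b hx
    obtain ⟨x₁, hx₁, x₂, hx₂, rfl⟩ := Submodule.mem_sup.1 hle
    rw [mul_add]
    refine (G N).add_mem (by rw [← hN]; exact hbase s hmem _ x₁ hx₁) ?_
    refine Submodule.mul_induction_on hx₂ ?_ fun y z hy hz => by
      rw [mul_add]; exact (G N).add_mem hy hz
    rintro _ ⟨q, hq, rfl⟩ u hu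
    obtain ⟨q₁, hq₁, q₂, hq₂, rfl⟩ := Submodule.mem_sup.1 hq
    obtain ⟨a, rfl⟩ := Submodule.mem_span_singleton.1 hq₁
    have hsplit : (s.map t).prod * (lam (a • e + q₂) * u) =
        a • ((s.map t).prod * u) + lam q₂ * ((s.map t).prod * u) := by
      rw [map_add, map_smul, hlam, add_mul, mul_add, smul_mul_assoc, one_mul, mul_smul_comm]
      ring
    rw [hsplit]
    refine (G N).add_mem ((G N).smul_mem a ?_) ?_
    · exact hG (by omega) (ihN (s.card + b) (by omega) s hs b hu rfl)
    · refine map_mul_prod_mul_mem hts (T := s.toFinset) (by simp) (fun i hi => ?_) hq₂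
      have hi' : i ∈ s := by simpa using hi
      have hc := herase hi'
      exact hG (by omega) (ihN ((s.erase i).card + b) (by omega) _
        (fun j hj => hs j (Multiset.mem_of_mem_erase hj)) b hu rfl)
  · simp only [NoBrokenCircuit] at h2
    push Not at h2
    obtain ⟨h, hr, hh⟩ := h2
    have := map_mul_prod_mul_mem (G := G N) (x := t h * x) hts (by simp +contextual)
      (fun i hi => ?_) hh
    · have h3 : lam (ℓ h) * ((s.map t).prod * (t h * x)) =
          t h * lam (ℓ h) * ((s.map t).prod * x) := by ring
      rwa [h3, ht h hr, one_mul] at this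
    · have hi' : i ∈ s := by simpa using hi.1
      have hlt : h < i := hi.2
      have hc := herase hi'
      have hsum : i + (s.erase i).sum = s.sum := by
        rw [← Multiset.sum_cons, Multiset.cons_erase hi']
      have := ihw (h + (s.erase i).sum) (by omega) (h ::ₘ s.erase i)
        (fun j hj => by
          rcases Multiset.mem_cons.1 hj with rfl | hj
          · exact hr
          · exact hs j (Multiset.mem_of_mem_erase hj))
        (by rw [Multiset.card_cons]; omega) (by simp)
      rwa [Multiset.map_cons, Multiset.prod_cons, mul_comm (t h), mul_assoc] at this

end Straightening

section UpperBound
variable {K V C : Type*} [Field K] [AddCommGroup V] [Module K V] [CommRing C] [Algebra K C]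

theorem finrank_span_finset_pow_le (F : Finset C) (k : ℕ) :
    Module.finrank K (Submodule.span K (F : Set C) ^ k : Submodule K C) ≤
      (F.card + k - 1).choose k := by
  classical
  have h : Submodule.span K (F : Set C) ^ k ≤
      Submodule.span K (Set.range fun s : Sym F k => ((s : Multiset F).map (↑)).prod) := by
    induction k with
    | zero =>
      rw [pow_zero, Submodule.one_le]
      exact Submodule.subset_span ⟨Sym.nil, by simp⟩
    | succ k ih =>
      rw [pow_succ']
      refine (mul_le_mul' le_rfl ih).trans ?_
      rw [Submodule.span_mul_span, Submodule.span_le]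
      rintro _ ⟨a, ha, _, ⟨s, rfl⟩, rfl⟩
      exact Submodule.subset_span ⟨(⟨a, ha⟩ : F) ::ₛ s, by
        simp only [Sym.coe_cons, Multiset.map_cons, Multiset.prod_cons]⟩
  have : FiniteDimensional K (Submodule.span K
      (Set.range fun s : Sym F k => ((s : Multiset F).map ((↑) : F → C)).prod)) :=
    FiniteDimensional.span_of_finite K (Set.finite_range _)
  refine (Submodule.finrank_mono h).trans ((finrank_range_le_card _).trans ?_)
  rw [Sym.card_sym_eq_choose, Fintype.card_coe]

theorem finrank_finset_sup_le {ι : Type*} (s : Finset ι) (W : ι → Submodule K V)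
    [∀ i, FiniteDimensional K (W i)] :
    Module.finrank K (s.sup W : Submodule K V) ≤ ∑ i ∈ s, Module.finrank K (W i) := by
  classical
  induction s using Finset.induction_on with
  | empty => rw [Finset.sup_empty, finrank_bot]; exact Nat.zero_le _
  | insert i s hi ih =>
    rw [Finset.sup_insert, Finset.sum_insert hi]
    exact (Submodule.finrank_add_le_finrank_add_finrank _ _).trans
      (add_le_add_right ih _)

theorem poleFilt_le {U : Submodule K C} {t : ℕ → C} {r k : ℕ} {G : Submodule K C}
    (h : ∀ s : Multiset ℕ, (∀ i ∈ s, i < r) → ∀ b, s.card + b = k → ∀ x ∈ U ^ b,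
      (s.map t).prod * x ∈ G) : poleFilt U t r k ≤ G := by
  have key : ∀ k, poleFilt U t r k ≤ Submodule.span K
      {y | ∃ s : Multiset ℕ, (∀ i ∈ s, i < r) ∧ ∃ b, s.card + b = k ∧ ∃ x ∈ U ^ b,
        (s.map t).prod * x = y} := by
    intro k
    induction k with
    | zero =>
      rw [poleFilt, pow_zero, Submodule.one_le]
      exact Submodule.subset_span ⟨0, by simp, 0, by simp, 1,
        by rw [pow_zero]; exact Submodule.one_le.1 le_rfl, by simp⟩
    | succ k ih =>
      have hU : U ⊔ Submodule.span K (t '' Set.Iio r) =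
          Submodule.span K ((U : Set C) ∪ t '' Set.Iio r) := by
        rw [Submodule.span_union, Submodule.span_eq]
      rw [poleFilt, pow_succ']
      refine (mul_le_mul' hU.le ih).trans ?_
      rw [Submodule.span_mul_span, Submodule.span_le]
      rintro _ ⟨u, hu, _, ⟨s, hs, b, hb, x, hx, rfl⟩, rfl⟩
      rcases hu with hu | ⟨i, hi, rfl⟩
      · refine Submodule.subset_span ⟨s, hs, b + 1, by omega, u * x, ?_, by simp only; ring⟩
        rw [pow_succ']
        exact Submodule.mul_mem_mul hu hx
      · refine Submodule.subset_span ⟨i ::ₘ s, fun j hj => ?_, b, ?_, x, hx, ?_⟩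
        · rcases Multiset.mem_cons.1 hj with rfl | hj
          · exact hi
          · exact hs j hj
        · rw [Multiset.card_cons]; omega
        · simp [mul_assoc]
  refine (key k).trans (Submodule.span_le.2 ?_)
  rintro _ ⟨s, hs, b, hb, x, hx, rfl⟩
  exact h s hs b hb x hx

theorem linearIndepOn_of_noBrokenCircuit {ℓ : ℕ → V} {r : ℕ} {S : Finset ℕ}
    (hSr : S ⊆ Finset.range r) (hS : NoBrokenCircuit K ℓ r S) : LinearIndepOn K ℓ (S : Set ℕ) := by
  induction S using Finset.induction_on_min with
  | empty => simp
  | insert a S ha ih =>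
    rw [Finset.coe_insert]
    refine LinearIndepOn.insert (ih (fun i hi => hSr (Finset.mem_insert_of_mem hi)) ?_) ?_
    · intro h hr hh
      refine hS h hr (Submodule.span_mono (Set.image_mono ?_) hh)
      rintro i ⟨hi, hlt⟩
      exact ⟨Finset.mem_insert_of_mem hi, hlt⟩
    · intro hh
      refine hS a (Finset.mem_range.1 (hSr (Finset.mem_insert_self a S)))
        (Submodule.span_mono (Set.image_mono ?_) hh)
      intro i hi
      exact ⟨Finset.mem_insert_of_mem hi, ha i hi⟩

theorem finrank_span_sup_span_image {ℓ : ℕ → V} {e : V} {r : ℕ} {S : Finset ℕ}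
    (he : e ≠ 0) (hS : S ∈ nbcSets K ℓ e r) :
    Module.finrank K (Submodule.span K {e} ⊔ Submodule.span K (ℓ '' S) : Submodule K V) =
      S.card + 1 := by
  obtain ⟨hSr, hnbc, hes⟩ := mem_nbcSets.1 hS
  have hfd : FiniteDimensional K (Submodule.span K (ℓ '' S)) :=
    FiniteDimensional.span_of_finite K (S.finite_toSet.image ℓ)
  have h := Submodule.finrank_sup_add_finrank_inf_eq (Submodule.span K {e})
    (Submodule.span K (ℓ '' S))
  rw [((Submodule.disjoint_span_singleton' he).2 hes).symm.eq_bot, finrank_bot, add_zero,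
    finrank_span_singleton he] at h
  have hli := linearIndepOn_of_noBrokenCircuit hSr hnbc
  have h2 := finrank_span_eq_card hli.linearIndependent
  rw [← Set.image_eq_range] at h2
  rw [h, h2, add_comm]
  simp

theorem exists_finset_span_of_mem_nbcSets {ℓ : ℕ → V} {e : V} {r n : ℕ} {S : Finset ℕ}
    (he : e ≠ 0) (hS : S ∈ nbcSets K ℓ e r) {U : Submodule K V} [FiniteDimensional K U]
    (hU : Module.finrank K U = n + 1) (heU : e ∈ U) (hℓ : ∀ i < r, ℓ i ∈ U) :
    ∃ F : Finset V, Submodule.span K (F : Set V) ≤ U ∧ F.card + S.card ≤ n ∧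
      U ≤ Submodule.span K (F : Set V) ⊔
        (Submodule.span K {e} ⊔ Submodule.span K (ℓ '' S)) := by
  classical
  have h1 := finrank_span_sup_span_image he hS
  set L := Submodule.span K {e} ⊔ Submodule.span K (ℓ '' S)
  have hLU : L ≤ U := by
    refine sup_le (by simpa using heU) (Submodule.span_le.2 ?_)
    rintro _ ⟨i, hi, rfl⟩
    exact hℓ i (Finset.mem_range.1 ((mem_nbcSets.1 hS).1 hi))
  obtain ⟨E, hdisj, hsup⟩ := IsModularLattice.exists_disjoint_and_sup_eq hLU
  have hEU : E ≤ U := hsup ▸ le_sup_right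
  have := Submodule.finiteDimensional_of_le hLU
  have := Submodule.finiteDimensional_of_le hEU
  have h2 := Submodule.finrank_sup_add_finrank_inf_eq L E
  rw [hdisj.eq_bot, finrank_bot, hsup, hU, h1] at h2
  let b := Module.finBasis K E
  have hspan :
    Submodule.span K ((Finset.univ.image fun i => (b i : V) : Finset V) : Set V) = E := by
    rw [Finset.coe_image, Finset.coe_univ, Set.image_univ]
    have h3 := congrArg (Submodule.map E.subtype) b.span_eq
    rw [Submodule.map_span, Submodule.map_top, Submodule.range_subtype, ← Set.range_comp] at h3
    exact h3
  refine ⟨Finset.univ.image fun i => (b i : V), hspan.trans_le hEU, ?_, ?_⟩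
  · have h4 := Finset.card_image_le (s := Finset.univ) (f := fun i => (b i : V))
    rw [Finset.card_univ, Fintype.card_fin] at h4
    omega
  · rw [hspan, sup_comm, hsup]

theorem finrank_map_poleFilt_le {M : Type*} [AddCommGroup M] [Module K M] (q : C →ₗ[K] M)
    {lam : V →ₗ[K] C} {e : V} {ℓ : ℕ → V} {t : ℕ → C} {r n : ℕ} (he : e ≠ 0) (hlam : lam e = 1)
    (ht : ∀ i < r, t i * lam (ℓ i) = 1) (h0 : ∅ ∈ nbcSets K ℓ e r) {U : Submodule K V}
    [FiniteDimensional K U] (hU : Module.finrank K U = n + 1) (heU : e ∈ U)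
    (hℓ : ∀ i < r, ℓ i ∈ U) (hq : ∀ b, ∀ x ∈ U.map lam ^ b, q x = 0) (k : ℕ) :
    Module.finrank K ((poleFilt (U.map lam) t r k).map q) ≤
      ((nbcSets K ℓ e r).card - 1) * (n + k).choose k := by
  classical
  have hex : ∀ S, ∃ F : Finset V, S ∈ nbcSets K ℓ e r →
      Submodule.span K (F : Set V) ≤ U ∧ F.card + S.card ≤ n ∧
      U ≤ Submodule.span K (F : Set V) ⊔
        (Submodule.span K {e} ⊔ Submodule.span K (ℓ '' S)) := fun S => by
    by_cases hS : S ∈ nbcSets K ℓ e r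
    · obtain ⟨F, hF⟩ := exists_finset_span_of_mem_nbcSets he hS hU heU hℓ
      exact ⟨F, fun _ => hF⟩
    · exact ⟨∅, fun h => absurd h hS⟩
  choose F hF using hex
  let gens : Finset ℕ → Finset C := fun S => insert 1 (S.image t ∪ (F S).image lam)
  let D : Finset ℕ → Submodule K C := fun S => Submodule.span K (gens S : Set C)
  have hX : ∀ S ∈ nbcSets K ℓ e r, (gens S).card ≤ n + 1 := fun S hS => by
    have h1 := Finset.card_insert_le 1 (S.image t ∪ (F S).image lam)
    have h2 := Finset.card_union_le (S.image t) ((F S).image lam)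
    have h3 := Finset.card_image_le (s := S) (f := t)
    have h4 := Finset.card_image_le (s := F S) (f := lam)
    have h5 := (hF S hS).2.1
    simp only [gens]
    omega
  have hDfd : ∀ S, FiniteDimensional K (D S) := fun S =>
    FiniteDimensional.span_of_finite K (gens S).finite_toSet
  have hDpow : ∀ k S, FiniteDimensional K (D S ^ k : Submodule K C) := fun k S =>
    finiteDimensional_pow _ k
  have hone : ∀ S, 1 ≤ D S := fun S =>
    Submodule.one_le.2 (Submodule.subset_span (Finset.mem_insert_self _ _))
  let G : ℕ → Submodule K C := fun k =>
    (((nbcSets K ℓ e r).erase ∅).sup fun S => D S ^ k) ⊔ LinearMap.ker q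
  have hG : Monotone G := fun a b hab =>
    sup_le_sup_right (Finset.sup_mono_fun fun S _ => pow_le_pow_right' (hone S) hab) _
  have hle : poleFilt (U.map lam) t r k ≤ G k := by
    refine poleFilt_le fun s hs b hb x hx => ?_
    rw [← hb]
    refine prod_mul_mem_of_nbcSets hlam ht hG
      (E := fun S => Submodule.span K (F S : Set V)) (fun S hS => (hF S hS).1)
      (fun S hS => (hF S hS).2.2) (fun s hs b x hx => ?_) s hs b hx
    by_cases hs0 : s = 0
    · subst hs0
      refine Submodule.mem_sup_right ?_
      rw [Multiset.map_zero, Multiset.prod_zero, one_mul, LinearMap.mem_ker]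
      have h1 : (Submodule.span K (F (Multiset.toFinset 0) : Set V)).map lam ^ b ≤ U.map lam ^ b :=
        pow_le_pow_left' (Submodule.map_mono (hF _ hs).1) b
      exact hq b x (h1 hx)
    · refine Submodule.mem_sup_left (Finset.le_sup (f := fun S => D S ^ (s.card + b))
        (b := s.toFinset) (Finset.mem_erase.2 ⟨by simpa using hs0, hs⟩) ?_)
      change _ ∈ D s.toFinset ^ _
      rw [pow_add]
      have h2 : (Submodule.span K (F s.toFinset : Set V)).map lam ≤ D s.toFinset := by
        rw [Submodule.map_span]
        refine Submodule.span_mono ?_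
        rw [← Finset.coe_image]
        exact Finset.coe_subset.2 (Finset.subset_union_right.trans (Finset.subset_insert _ _))
      have h3 : (Submodule.span K (F s.toFinset : Set V)).map lam ^ b ≤ D s.toFinset ^ b :=
        pow_le_pow_left' h2 b
      refine Submodule.mul_mem_mul ?_ (h3 hx)
      · have h1 : ∀ s' ≤ s, (s'.map t).prod ∈ D s.toFinset ^ s'.card := by
          intro s'
          induction s' using Multiset.induction_on with
          | empty => intro _; simpa using Submodule.one_le.1 (le_refl (1 : Submodule K C))
          | cons i s' ih =>
            intro hle
            rw [Multiset.map_cons, Multiset.prod_cons, Multiset.card_cons, pow_succ']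
            refine Submodule.mul_mem_mul (Submodule.subset_span ?_)
              (ih ((Multiset.le_cons_self _ _).trans hle))
            have : i ∈ s := Multiset.mem_of_le hle (Multiset.mem_cons_self i s')
            simp only [gens, Finset.mem_coe, Finset.mem_insert, Finset.mem_union, Finset.mem_image]
            exact Or.inr (Or.inl ⟨i, by simpa using this, rfl⟩)
        exact h1 s le_rfl
  have h1 : (poleFilt (U.map lam) t r k).map q ≤
      (((nbcSets K ℓ e r).erase ∅).sup fun S => D S ^ k).map q := by
    refine (Submodule.map_mono hle).trans ?_
    rw [Submodule.map_sup, LinearMap.le_ker_iff_map.1 le_rfl, sup_bot_eq]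
  refine (Submodule.finrank_mono h1).trans ((Submodule.finrank_map_le _ _).trans
    ((finrank_finset_sup_le _ _).trans ?_))
  rw [← Finset.card_erase_of_mem h0, ← smul_eq_mul]
  refine Finset.sum_le_card_nsmul _ _ _ fun S hS => ?_
  have h2 := hX S (Finset.mem_of_mem_erase hS)
  exact (finrank_span_finset_pow_le _ _).trans (Nat.choose_le_choose _ (by omega))

end UpperBound

section
variable {K : Type*} [Field K] {n : ℕ}

theorem finrank_affineForms : Module.finrank K (affineForms K n) = n + 1 := by
  classical
  let g : affineForms K n →ₗ[K] K × (Fin n → K) :=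
    ((MvPolynomial.lcoeff K 0).prod
      (LinearMap.pi fun i => MvPolynomial.lcoeff K (Finsupp.single i 1))).domRestrict _
  have hg : ∀ u, g u = (MvPolynomial.coeff 0 u.1,
    fun i => MvPolynomial.coeff (Finsupp.single i 1) u.1) := fun u => rfl
  have h1 : Function.Injective g := by
    rw [injective_iff_map_eq_zero]
    intro u hu
    rw [hg, Prod.mk_eq_zero] at hu
    refine Subtype.ext ?_
    rw [eq_of_mem_affineForms u.2, hu.1]
    have h3 := fun i => congrFun hu.2 i
    simp only [Pi.zero_apply] at h3
    simp [h3]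
  have h2 : Function.Surjective g := by
    rintro ⟨a, b⟩
    refine ⟨⟨MvPolynomial.C a + ∑ i, MvPolynomial.C (b i) * MvPolynomial.X i, ?_⟩, ?_⟩
    · refine Submodule.add_mem _ ?_ (Submodule.sum_mem _ fun i _ => ?_)
      · rw [mem_restrictTotalDegree, totalDegree_C]; exact Nat.zero_le _
      · rw [mem_restrictTotalDegree]
        refine (totalDegree_mul _ _).trans ?_
        rw [totalDegree_C, totalDegree_X]
    · rw [hg]
      refine Prod.ext ?_ (funext fun i => ?_)
      · simp [MvPolynomial.coeff_sum]
      · have h0 : (0 : Fin n →₀ ℕ) ≠ Finsupp.single i 1 := by simp [eq_comm]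
        simp [MvPolynomial.coeff_sum, MvPolynomial.coeff_C, h0, MvPolynomial.coeff_C_mul,
          MvPolynomial.coeff_X, Finsupp.single_left_inj]
  rw [(LinearEquiv.ofBijective g ⟨h1, h2⟩).finrank_eq]
  simp [add_comm]

end

section LinearParts
variable {K : Type*} [Field K] {n : ℕ}

variable (K n) in
/-- The coefficients of the linear part of a polynomial. -/
noncomputable def linPart : MvPolynomial (Fin n) K →ₗ[K] (Fin n → K) :=
  LinearMap.pi fun j => MvPolynomial.lcoeff K (Finsupp.single j 1)

theorem linPart_apply (u : MvPolynomial (Fin n) K) (j : Fin n) :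
    linPart K n u j = MvPolynomial.coeff (Finsupp.single j 1) u := rfl

theorem eval_of_mem_affineForms {u : MvPolynomial (Fin n) K} (hu : u ∈ affineForms K n)
    (x : Fin n → K) : MvPolynomial.eval x u = MvPolynomial.coeff 0 u + linPart K n u ⬝ᵥ x := by
  conv_lhs => rw [eq_of_mem_affineForms hu]
  simp [dotProduct, linPart_apply]

theorem surjective_linPart_dotProduct {ℓ : ℕ → MvPolynomial (Fin n) K} {r : ℕ} {S : Finset ℕ}
    (hℓ : ∀ i < r, ℓ i ∈ affineForms K n) (hS : S ∈ nbcSets K ℓ 1 r) :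
    Function.Surjective
      (Matrix.mulVecLin (Matrix.of fun (i : S) => linPart K n (ℓ i))) := by
  obtain ⟨hSr, hnbc, h1⟩ := mem_nbcSets.1 hS
  have hli := linearIndepOn_of_noBrokenCircuit hSr hnbc
  have hspan : Submodule.span K (ℓ '' (S : Set ℕ)) ≤ affineForms K n := by
    rw [Submodule.span_le]
    rintro _ ⟨i, hi, rfl⟩
    exact hℓ i (Finset.mem_range.1 (hSr hi))
  have hinj : Set.InjOn (linPart K n) (Submodule.span K (ℓ '' (S : Set ℕ))) := by
    intro u hu v hv huv
    by_contra hne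
    apply h1
    have hw : u - v ∈ Submodule.span K (ℓ '' (S : Set ℕ)) := Submodule.sub_mem _ hu hv
    have h0 : linPart K n (u - v) = 0 := by rw [map_sub, huv, sub_self]
    have hC : u - v = MvPolynomial.coeff 0 (u - v) • 1 := by
      conv_lhs => rw [eq_of_mem_affineForms (hspan hw)]
      simp only [← linPart_apply, h0]
      simp [MvPolynomial.smul_eq_C_mul]
    have hc : MvPolynomial.coeff 0 (u - v) ≠ 0 := fun h => by
      rw [h, zero_smul, sub_eq_zero] at hC
      exact hne hC
    have := Submodule.smul_mem _ (MvPolynomial.coeff 0 (u - v))⁻¹ hw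
    rwa [hC, smul_smul, MvPolynomial.coeff_smul, MvPolynomial.coeff_zero_one, smul_eq_mul,
      mul_one, inv_mul_cancel₀ hc, one_smul] at this
  have hli2 : LinearIndependent K (Matrix.of fun (i : S) => linPart K n (ℓ i)).row :=
    (hli.map_injOn _ hinj).linearIndependent
  have hrank := hli2.rank_matrix
  rw [← LinearMap.range_eq_top]
  apply Submodule.eq_top_of_finrank_eq
  rw [Module.finrank_fintype_fun_eq_card, ← hrank]
  rfl

/-- The common zero locus of a subspace of polynomials. -/
def zeroLocusOf (L : Submodule K (MvPolynomial (Fin n) K)) : Set (Fin n → K) :=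
  {x | ∀ p ∈ L, MvPolynomial.eval x p = 0}

theorem mem_zeroLocusOf_span {T : Set (MvPolynomial (Fin n) K)} {x : Fin n → K} :
    x ∈ zeroLocusOf (Submodule.span K T) ↔ ∀ p ∈ T, MvPolynomial.eval x p = 0 := by
  refine ⟨fun h p hp => h p (Submodule.subset_span hp), fun h p hp => ?_⟩
  induction hp using Submodule.span_induction with
  | mem p hp => exact h p hp
  | zero => simp
  | add p q _ _ hp hq => simp [hp, hq]
  | smul a p _ hp => simp [MvPolynomial.smul_eval, hp]

theorem zeroLocusOf_eq_empty {L : Submodule K (MvPolynomial (Fin n) K)} (h : 1 ∈ L) :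
    zeroLocusOf L = ∅ :=
  Set.eq_empty_of_forall_notMem fun x hx => by simpa using hx 1 h

end LinearParts

section
variable {K : Type} [Field K] {n : ℕ}

theorem zeroLocusOf_of_mem_nbcSets {ℓ : ℕ → MvPolynomial (Fin n) K} {r : ℕ} {S : Finset ℕ}
    (hℓ : ∀ i < r, ℓ i ∈ affineForms K n) (hS : S ∈ nbcSets K ℓ 1 r) :
    (zeroLocusOf (Submodule.span K (ℓ '' S))).Nonempty ∧
      codim K n Set.univ (zeroLocusOf (Submodule.span K (ℓ '' S))) = S.card := by
  have hsurj := surjective_linPart_dotProduct hℓ hS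
  have hSr := (mem_nbcSets.1 hS).1
  set T := Matrix.mulVecLin (Matrix.of fun (i : S) => linPart K n (ℓ i)) with hT
  obtain ⟨x₀, hx₀⟩ := hsurj fun i => - MvPolynomial.coeff 0 (ℓ i)
  have hlocus : zeroLocusOf (Submodule.span K (ℓ '' S)) =
      (AffineSubspace.mk' x₀ (LinearMap.ker T) : Set (Fin n → K)) := by
    ext x
    rw [mem_zeroLocusOf_span, SetLike.mem_coe, AffineSubspace.mem_mk', vsub_eq_sub,
      LinearMap.mem_ker, map_sub, sub_eq_zero, hx₀, funext_iff]
    simp only [Set.forall_mem_image, Finset.mem_coe, Subtype.forall]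
    refine forall_congr' fun i => forall_congr' fun hi => ?_
    rw [eval_of_mem_affineForms (hℓ i (Finset.mem_range.1 (hSr hi))), add_comm,
      add_eq_zero_iff_eq_neg]
    rfl
  refine ⟨hlocus ▸ AffineSubspace.mk'_nonempty _ _, ?_⟩
  have hker := LinearMap.finrank_range_add_finrank_ker T
  rw [LinearMap.range_eq_top.2 hsurj, finrank_top, Module.finrank_fintype_fun_eq_card,
    Module.finrank_fintype_fun_eq_card, Fintype.card_coe, Fintype.card_fin] at hker
  rw [codim, hlocus, ← AffineSubspace.direction_eq_vectorSpan, AffineSubspace.direction_mk',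
    ← AffineSubspace.top_coe K (Fin n → K) (Fin n → K), ← AffineSubspace.direction_eq_vectorSpan,
    AffineSubspace.direction_top, finrank_top, Module.finrank_fintype_fun_eq_card, Fintype.card_fin]
  omega

open scoped Classical in
theorem eval_one_poin {ℓ : ℕ → MvPolynomial (Fin n) K} {r : ℕ}
    (hℓ : ∀ i < r, ℓ i ∈ affineForms K n) (hℓ1 : ∀ i < r, ℓ i ∉ Submodule.span K {1})
    (𝒜 : Finset (Set (Fin n → K)))
    (h𝒜 : 𝒜 = (Finset.range r).image fun i => zeroSet K n (ℓ i))
    (μ : Set (Fin n → K) → ℤ) (hμ : IsMobius K n Set.univ 𝒜 μ) :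
    (poin K n Set.univ 𝒜 μ).eval 1 = (nbcSets K ℓ 1 r).card := by
  let V : Finset ℕ → Set (Fin n → K) := fun S => zeroLocusOf (Submodule.span K (ℓ '' S))
  have hV : ∀ S x, x ∈ V S ↔ ∀ i ∈ S, MvPolynomial.eval x (ℓ i) = 0 := fun S x => by
    simp only [V, mem_zeroLocusOf_span, Set.forall_mem_image, Finset.mem_coe]
  have hP : ∀ X, X ∈ interPoset K n Set.univ 𝒜 ↔ X ≠ ∅ ∧ ∃ S ⊆ Finset.range r, V S = X := by
    intro X
    have hVS : ∀ S : Finset ℕ,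
        Set.univ ∩ ⋂ H ∈ S.image (fun i => zeroSet K n (ℓ i)), H = V S := fun S => by
      ext x
      simp [hV, zeroSet]
    rw [interPoset, Finset.mem_filter, Finset.mem_image, and_comm, h𝒜]
    refine and_congr_right fun _ => ⟨?_, ?_⟩
    · rintro ⟨T, hT, rfl⟩
      obtain ⟨S, hS, rfl⟩ := Finset.subset_image_iff.1 (Finset.mem_powerset.1 hT)
      exact ⟨S, hS, (hVS S).symm⟩
    · rintro ⟨S, hS, rfl⟩
      exact ⟨_, Finset.mem_powerset.2 (Finset.image_subset_image hS), hVS S⟩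
  let ν : Set (Fin n → K) → ℤ := fun X =>
    ∑ S ∈ (Finset.range r).powerset.filter (fun S => V S = X), (-1) ^ S.card
  have hνtop : ν Set.univ = 1 := by
    have : (Finset.range r).powerset.filter (fun S => V S = Set.univ) = {∅} := by
      ext S
      rw [Finset.mem_filter, Finset.mem_powerset, Finset.mem_singleton]
      constructor
      · rintro ⟨hS, hVS⟩
        by_contra hne
        obtain ⟨i, hi⟩ := Finset.nonempty_iff_ne_empty.2 hne
        have hir := Finset.mem_range.1 (hS hi)
        obtain ⟨j, hj⟩ := exists_coeff_ne_zero (hℓ i hir) (hℓ1 i hir)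
        have hz : ∀ x, MvPolynomial.eval x (ℓ i) = 0 := fun x =>
          (hV S x).1 (hVS ▸ Set.mem_univ x) i hi
        have h0 := hz 0
        have h1 := hz (Pi.single j 1)
        rw [eval_of_mem_affineForms (hℓ i hir)] at h0 h1
        rw [dotProduct_zero, add_zero] at h0
        rw [h0, zero_add, dotProduct_single_one] at h1
        exact hj h1
      · rintro rfl
        refine ⟨Finset.empty_subset _, Set.eq_univ_of_forall fun x => ?_⟩
        rw [hV]; simp
    simp only [ν, this]
    simp
  have hsum : ∀ (P : Set (Fin n → K) → Prop) (g : Set (Fin n → K) → ℤ),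
      ∑ X ∈ (interPoset K n Set.univ 𝒜).filter P, ν X * g X =
      ∑ S ∈ (Finset.range r).powerset.filter (fun S => V S ≠ ∅ ∧ P (V S)),
        (-1) ^ S.card * g (V S) := by
    intro P g
    rw [← Finset.sum_fiberwise_of_maps_to (g := V)
      (t := (interPoset K n Set.univ 𝒜).filter P)]
    · refine Finset.sum_congr rfl fun X hX => ?_
      obtain ⟨hX1, hX2⟩ := Finset.mem_filter.1 hX
      simp only [ν]
      rw [Finset.sum_mul, Finset.filter_filter]
      refine Finset.sum_congr ?_ fun S hS => ?_
      · refine Finset.filter_congr fun S _ => ⟨fun h => ⟨?_, h⟩, fun h => h.2⟩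
        subst h
        exact ⟨((hP _).1 hX1).1, hX2⟩
      · rw [(Finset.mem_filter.1 hS).2.2]
    · intro S hS
      rw [Finset.mem_filter, Finset.mem_powerset] at hS
      exact Finset.mem_filter.2 ⟨(hP _).2 ⟨hS.2.1, S, hS.1, rfl⟩, hS.2.2⟩
  have hνsum : ∀ Y ∈ interPoset K n Set.univ 𝒜, Y ≠ Set.univ →
      ∑ Z ∈ (interPoset K n Set.univ 𝒜).filter (fun Z => Y ⊆ Z), ν Z = 0 := by
    intro Y hY hYne
    obtain ⟨hY0, S₀, hS₀, rfl⟩ := (hP Y).1 hY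
    have h1 := hsum (fun Z => V S₀ ⊆ Z) (fun _ => 1)
    simp only [mul_one] at h1
    rw [h1]
    have h2 : (Finset.range r).powerset.filter (fun S => V S ≠ ∅ ∧ V S₀ ⊆ V S) =
        ((Finset.range r).filter fun i => V S₀ ⊆ V {i}).powerset := by
      ext S
      simp only [Finset.mem_filter, Finset.mem_powerset]
      constructor
      · rintro ⟨hS, -, hle⟩ i hi
        refine Finset.mem_filter.2 ⟨hS hi, fun x hx => ?_⟩
        rw [hV]
        intro j hj
        rw [Finset.mem_singleton.1 hj]
        exact (hV S x).1 (hle hx) i hi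
      · intro hS
        have hle : V S₀ ⊆ V S := fun x hx => (hV S x).2 fun i hi =>
          (hV {i} x).1 ((Finset.mem_filter.1 (hS hi)).2 hx) i (Finset.mem_singleton_self i)
        refine ⟨fun i hi => (Finset.mem_filter.1 (hS hi)).1, fun h => hY0 ?_, hle⟩
        exact Set.subset_empty_iff.1 (h ▸ hle)
    rw [h2]
    apply Finset.sum_powerset_neg_one_pow_card_of_nonempty
    have hne : S₀.Nonempty := by
      rw [Finset.nonempty_iff_ne_empty]
      rintro rfl
      exact hYne (Set.eq_univ_of_forall fun x => by rw [hV]; simp)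
    obtain ⟨i, hi⟩ := hne
    refine ⟨i, Finset.mem_filter.2 ⟨hS₀ hi, fun x hx => (hV {i} x).2 fun j hj => ?_⟩⟩
    rw [Finset.mem_singleton.1 hj]
    exact (hV S₀ x).1 hx i hi
  have hμν : ∀ Y ∈ interPoset K n Set.univ 𝒜, μ Y = ν Y := by
    intro Y hY
    induction hc : ((interPoset K n Set.univ 𝒜).filter (fun Z => Y ⊆ Z)).card
      using Nat.strong_induction_on generalizing Y with
    | _ c ih =>
    by_cases hYu : Y = Set.univ
    · rw [hYu, hμ.1, hνtop]
    have h1 := hμ.2 Y hY hYu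
    have h2 := hνsum Y hY hYu
    have hmem : Y ∈ (interPoset K n Set.univ 𝒜).filter (fun Z => Y ⊆ Z) :=
      Finset.mem_filter.2 ⟨hY, subset_rfl⟩
    rw [← Finset.add_sum_erase _ _ hmem] at h1 h2
    have h3 : ∑ Z ∈ ((interPoset K n Set.univ 𝒜).filter (fun Z => Y ⊆ Z)).erase Y, μ Z =
        ∑ Z ∈ ((interPoset K n Set.univ 𝒜).filter (fun Z => Y ⊆ Z)).erase Y, ν Z := by
      refine Finset.sum_congr rfl fun Z hZ => ?_
      obtain ⟨hne, hZ⟩ := Finset.mem_erase.1 hZ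
      obtain ⟨hZP, hYZ⟩ := Finset.mem_filter.1 hZ
      refine ih _ ?_ Z hZP rfl
      rw [← hc]
      refine Finset.card_lt_card ⟨fun W hW => ?_, fun h => ?_⟩
      · rw [Finset.mem_filter] at *
        exact ⟨hW.1, hYZ.trans hW.2⟩
      · exact hne ((Finset.mem_filter.1 (h hmem)).2.antisymm hYZ)
    omega
  have heval : (poin K n Set.univ 𝒜 μ).eval 1 =
      ∑ X ∈ interPoset K n Set.univ 𝒜, ν X * (-1) ^ codim K n Set.univ X := by
    rw [poin, Polynomial.eval_finsetSum]
    exact Finset.sum_congr rfl fun X hX => by simp [hμν X hX]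
  let c : Submodule K (MvPolynomial (Fin n) K) → ℤ := fun L =>
    if zeroLocusOf L ≠ ∅ then (-1) ^ codim K n Set.univ (zeroLocusOf L) else 0
  have h4 := hsum (fun _ => True) (fun X => (-1) ^ codim K n Set.univ X)
  rw [Finset.filter_true] at h4
  rw [heval, h4]
  have h5 := sum_neg_one_pow_card_eq_sum_noBrokenCircuit ℓ r c
  simp only [c, mul_ite, mul_zero] at h5
  rw [← Finset.sum_filter] at h5
  simp only [and_true]
  refine h5.trans ?_
  have h6 : nbcSets K ℓ 1 r = ((Finset.range r).powerset.filter (NoBrokenCircuit K ℓ r)).filter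
      fun S : Finset ℕ => 1 ∉ Submodule.span K (ℓ '' (S : Set ℕ)) := by
    ext S
    simp [mem_nbcSets, and_assoc]
  rw [Finset.card_eq_sum_ones, Nat.cast_sum, h6]
  conv_rhs => rw [Finset.sum_filter]
  refine Finset.sum_congr rfl fun S hS => ?_
  rw [Finset.mem_filter, Finset.mem_powerset] at hS
  by_cases h1 : 1 ∈ Submodule.span K (ℓ '' (S : Set ℕ))
  · rw [if_neg (by simp [zeroLocusOf_eq_empty h1]), if_neg (by simpa using h1)]
  · obtain ⟨hne, hcod⟩ := zeroLocusOf_of_mem_nbcSets hℓ (mem_nbcSets.2 ⟨hS.1, hS.2, h1⟩)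
    rw [if_pos hne.ne_empty, if_pos h1, hcod, ← pow_add, Even.neg_one_pow ⟨_, rfl⟩, Nat.cast_one]

end

section Weyl
variable {K : Type} [Field K] {n : ℕ}

theorem mul_prod_map_pow {A ι : Type*} [Monoid A] [DecidableEq ι] (g : ι → A)
    (hg : ∀ i j, g i * g j = g j * g i) (a : ι → ℕ) {i : ι} :
    ∀ {l : List ι}, l.Nodup → i ∈ l → g i * (l.map fun j => g j ^ a j).prod =
      (l.map fun j => g j ^ (a + Pi.single i 1 : ι → ℕ) j).prod
  | [], _, hi => by simp at hi
  | j :: l, hl, hi => by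
    rw [List.nodup_cons] at hl
    rw [List.map_cons, List.prod_cons, List.map_cons, List.prod_cons]
    by_cases hij : i = j
    · subst hij
      have h1 : (l.map fun j => g j ^ (a + Pi.single i 1 : ι → ℕ) j) =
          l.map fun j => g j ^ a j := by
        refine List.map_congr_left fun j hj => ?_
        rw [Pi.add_apply, Pi.single_eq_of_ne (fun h : j = i => hl.1 (h ▸ hj)), add_zero]
      rw [h1, ← mul_assoc, Pi.add_apply, Pi.single_eq_same, pow_succ']
    · have h1 := mul_prod_map_pow g hg a hl.2 ((List.mem_cons.1 hi).resolve_left hij)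
      have h2 : Commute (g i) (g j ^ a j) := Commute.pow_right (hg i j) _
      rw [← h1, ← mul_assoc, h2.eq, mul_assoc, Pi.add_apply,
        Pi.single_eq_of_ne (Ne.symm hij), add_zero]

/-- The span of the monomials of degree at most `k` in a commuting family. -/
noncomputable def monomialSpan {A : Type*} [Ring A] [Algebra K A] (g : Fin n → A) (k : ℕ) :
    Submodule K A :=
  Submodule.span K {w | ∃ a : Fin n → ℕ, ∑ i, a i ≤ k ∧
    w = ((List.finRange n).map fun i => g i ^ a i).prod}

section
variable {A : Type*} [Ring A] [Algebra K A] {g : Fin n → A}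

theorem monomialSpan_mono {j k : ℕ} (h : j ≤ k) : monomialSpan (K := K) g j ≤ monomialSpan g k := by
  refine Submodule.span_mono ?_
  rintro _ ⟨a, ha, rfl⟩
  exact ⟨a, ha.trans h, rfl⟩

theorem one_mem_monomialSpan (k : ℕ) : (1 : A) ∈ monomialSpan (K := K) g k := by
  refine Submodule.subset_span ⟨0, by simp, ?_⟩
  rw [List.prod_eq_one]
  intro x hx
  obtain ⟨i, -, rfl⟩ := List.mem_map.1 hx
  simp

theorem mul_mem_monomialSpan (hg : ∀ i j, g i * g j = g j * g i) (i : Fin n) {k : ℕ} {w : A}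
    (hw : w ∈ monomialSpan (K := K) g k) : g i * w ∈ monomialSpan (K := K) g (k + 1) := by
  induction hw using Submodule.span_induction with
  | mem w hw =>
    obtain ⟨a, ha, rfl⟩ := hw
    rw [mul_prod_map_pow g hg a (List.nodup_finRange n) (List.mem_finRange i)]
    refine Submodule.subset_span ⟨_, ?_, rfl⟩
    simp only [Pi.add_apply, Finset.sum_add_distrib]
    simpa using ha
  | zero => simp
  | add v w _ _ hv hw => rw [mul_add]; exact Submodule.add_mem _ hv hw
  | smul c w _ hw => rw [mul_smul_comm]; exact Submodule.smul_mem _ c hw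

end

theorem wX_mul_comm (i j : Fin n) : wX K n i * wX K n j = wX K n j * wX K n i := by
  rw [wX, wX, ← map_mul, ← map_mul]
  exact RingQuot.mkAlgHom_rel K (WeylRel.xx i j)

theorem wD_mul_comm (i j : Fin n) : wD K n i * wD K n j = wD K n j * wD K n i := by
  rw [wD, wD, ← map_mul, ← map_mul]
  exact RingQuot.mkAlgHom_rel K (WeylRel.dd i j)

theorem mul_mem_bernsteinF {j k : ℕ} {v w : Weyl K n} (hv : v ∈ monomialSpan (K := K) (wX K n) j)
    (hw : w ∈ monomialSpan (K := K) (wD K n) k) : v * w ∈ bernsteinF K n (j + k : ℕ) := by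
  have h := Submodule.mul_mem_mul hv hw
  rw [monomialSpan, monomialSpan, Submodule.span_mul_span] at h
  refine Submodule.span_mono ?_ h
  rintro _ ⟨_, ⟨a, ha, rfl⟩, _, ⟨b, hb, rfl⟩, rfl⟩
  exact ⟨a, b, by push_cast at ha hb ⊢; exact_mod_cast add_le_add ha hb, rfl⟩

theorem bernsteinF_mono {j k : ℤ} (h : j ≤ k) : bernsteinF K n j ≤ bernsteinF K n k := by
  refine Submodule.span_mono ?_
  rintro _ ⟨a, b, hab, rfl⟩
  exact ⟨a, b, hab.trans h, rfl⟩

theorem Weyl.induction {P : Weyl K n → Prop} (hK : ∀ c : K, P (algebraMap K _ c))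
    (hX : ∀ i, P (wX K n i)) (hD : ∀ i, P (wD K n i)) (hmul : ∀ v w, P v → P w → P (v * w))
    (hadd : ∀ v w, P v → P w → P (v + w)) (w : Weyl K n) : P w := by
  obtain ⟨a, rfl⟩ := RingQuot.mkAlgHom_surjective K (WeylRel K n) w
  induction a using FreeAlgebra.induction with
  | grade0 c => rw [AlgHom.commutes]; exact hK c
  | grade1 x =>
    cases x with
    | inl i => exact hX i
    | inr i => exact hD i
  | mul a b ha hb => rw [map_mul]; exact hmul _ _ ha hb
  | add a b ha hb => rw [map_add]; exact hadd _ _ ha hb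

section
variable {M : Type*} [AddCommGroup M] [Module K M] [Module (Weyl K n) M]

variable (K n) in
/-- The span of the products of operators in `bernsteinF k` with vectors of `P`. -/
noncomputable def bernsteinSpan (k : ℤ) (P : Submodule K M) : Submodule K M :=
  Submodule.span K {m | ∃ w ∈ bernsteinF K n k, ∃ v ∈ P, m = w • v}

theorem bernsteinSpan_mono {j k : ℤ} (h : j ≤ k) {P Q : Submodule K M} (hPQ : P ≤ Q) :
    bernsteinSpan K n j P ≤ bernsteinSpan K n k Q := by
  refine Submodule.span_mono ?_
  rintro _ ⟨w, hw, v, hv, rfl⟩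
  exact ⟨w, bernsteinF_mono h hw, v, hPQ hv, rfl⟩

theorem prod_map_pow_smul_mem {P : ℕ → Submodule K M} (g : Fin n → Weyl K n)
    (hg : ∀ i k, ∀ m ∈ P k, g i • m ∈ P (k + 1)) (a : Fin n → ℕ) (l : List (Fin n)) (k : ℕ) {m : M}
    (hm : m ∈ P k) : (l.map fun i => g i ^ a i).prod • m ∈ P ((l.map a).sum + k) := by
  induction l with
  | nil => simpa using hm
  | cons i l ih =>
    have hpow : ∀ b k, ∀ m ∈ P k, g i ^ b • m ∈ P (b + k) := by
      intro b
      induction b with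
      | zero => intro k m hm; simpa using hm
      | succ b ihb =>
        intro k m hm
        rw [pow_succ', mul_smul, add_right_comm]
        exact hg i _ _ (ihb k m hm)
    rw [List.map_cons (f := fun i => g i ^ a i), List.prod_cons, mul_smul,
      List.map_cons, List.sum_cons, add_assoc]
    exact hpow _ _ _ ih

variable [IsScalarTower K (Weyl K n) M]

theorem bernsteinF_smul_mem {P : ℕ → Submodule K M} (hP : Monotone P)
    (hX : ∀ i k, ∀ m ∈ P k, wX K n i • m ∈ P (k + 1))
    (hD : ∀ i k, ∀ m ∈ P k, wD K n i • m ∈ P (k + 1)) {j : ℤ} {k l : ℕ} (hl : j + k ≤ l)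
    {w : Weyl K n} (hw : w ∈ bernsteinF K n j) {m : M} (hm : m ∈ P k) : w • m ∈ P l := by
  induction hw using Submodule.span_induction with
  | mem w hw =>
    obtain ⟨a, b, hab, rfl⟩ := hw
    rw [mul_smul]
    have h1 := prod_map_pow_smul_mem (wD K n) hD b (List.finRange n) k hm
    have h2 := prod_map_pow_smul_mem (wX K n) hX a (List.finRange n) _ h1
    rw [← Fin.sum_univ_def, ← Fin.sum_univ_def] at h2
    exact hP (by omega) h2
  | zero => simp
  | add v w _ _ hv hw => rw [add_smul]; exact Submodule.add_mem _ hv hw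
  | smul c w _ hw => rw [smul_assoc]; exact Submodule.smul_mem _ c hw

end
end Weyl

section WeylAction

theorem prod_map_mem_pow {K B : Type*} [Field K] [CommRing B] [Algebra K B] {D : Submodule K B}
    {t : ℕ → B} {s : Multiset ℕ} (h : ∀ i ∈ s, t i ∈ D) : (s.map t).prod ∈ D ^ s.card := by
  induction s using Multiset.induction_on with
  | empty => simpa using Submodule.one_le.1 (le_refl (1 : Submodule K B))
  | cons i s ih =>
    rw [Multiset.map_cons, Multiset.prod_cons, Multiset.card_cons, pow_succ']
    exact Submodule.mul_mem_mul (h i (Multiset.mem_cons_self i s))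
      (ih fun j hj => h j (Multiset.mem_cons_of_mem hj))

variable {K : Type} [Field K] {n : ℕ} {B : Type*} [CommRing B] [Algebra K B]
  [Module (Weyl K n) B]

/-- In the action of the Weyl algebra on an algebra over the polynomial ring, `x_i` acts by
multiplication and `∂_i` acts by a derivation extending the partial derivative. -/
def ActsNaturally (lam : MvPolynomial (Fin n) K →ₐ[K] B) : Prop :=
  (∀ i (m : B), wX K n i • m = lam (MvPolynomial.X i) * m) ∧
  ∀ i, ∃ δ : Derivation K B B, (∀ m, wD K n i • m = δ m) ∧
    ∀ r, δ (lam r) = lam (MvPolynomial.pderiv i r)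

variable {lam : MvPolynomial (Fin n) K →ₐ[K] B}

theorem pderiv_of_mem_affineForms {u : MvPolynomial (Fin n) K} (hu : u ∈ affineForms K n)
    (i : Fin n) : MvPolynomial.pderiv i u = MvPolynomial.C (linPart K n u i) := by
  conv_lhs => rw [eq_of_mem_affineForms hu]
  simp [linPart_apply, MvPolynomial.pderiv_X, Pi.single_apply]

section
variable [IsScalarTower K (Weyl K n) B]

theorem coe_span_range_of_actsNaturally (h : ActsNaturally lam) :
    (Submodule.span (Weyl K n) (Set.range lam) : Set B) = Set.range lam := by
  have hw : ∀ w : Weyl K n, ∀ m ∈ Set.range lam, w • m ∈ Set.range lam := by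
    intro w
    induction w using Weyl.induction with
    | hK c =>
      rintro _ ⟨p, rfl⟩
      exact ⟨c • p, by rw [algebraMap_smul, map_smul]⟩
    | hX i =>
      rintro _ ⟨p, rfl⟩
      exact ⟨MvPolynomial.X i * p, by rw [h.1, map_mul]⟩
    | hD i =>
      rintro _ ⟨p, rfl⟩
      obtain ⟨δ, h1, h2⟩ := h.2 i
      exact ⟨MvPolynomial.pderiv i p, by rw [h1, h2]⟩
    | hmul v w hv hw =>
      intro m hm
      rw [mul_smul]
      exact hv _ (hw _ hm)
    | hadd v w hv hw =>
      intro m hm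
      obtain ⟨a, ha⟩ := hv m hm
      obtain ⟨b, hb⟩ := hw m hm
      exact ⟨a + b, by rw [map_add, ha, hb, add_smul]⟩
  let N : Submodule (Weyl K n) B :=
    { carrier := Set.range lam
      add_mem' := by
        rintro _ _ ⟨a, rfl⟩ ⟨b, rfl⟩
        exact ⟨a + b, map_add _ _ _⟩
      zero_mem' := ⟨0, map_zero _⟩
      smul_mem' := fun w m hm => hw w m hm }
  refine Set.Subset.antisymm ?_ Submodule.subset_span
  exact (Submodule.span_le (p := N)).2 subset_rfl

end

theorem exists_monomialSpan_wX_smul [IsScalarTower K (Weyl K n) B] (h : ActsNaturally lam) (b : ℕ)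
    {x : B} (hx : x ∈ (affineForms K n).map lam.toLinearMap ^ b) :
    ∃ w ∈ monomialSpan (K := K) (wX K n) b, ∀ m : B, w • m = x * m := by
  induction b generalizing x with
  | zero =>
    rw [pow_zero, Submodule.mem_one] at hx
    obtain ⟨c, rfl⟩ := hx
    refine ⟨c • 1, Submodule.smul_mem _ _ (one_mem_monomialSpan 0), fun m => ?_⟩
    rw [smul_assoc, one_smul, Algebra.smul_def]
  | succ b ih =>
    rw [pow_succ'] at hx
    induction hx using Submodule.mul_induction_on' with
    | mem_mul_mem u hu y hy =>
      obtain ⟨u, hu, rfl⟩ := hu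
      obtain ⟨w, hw, hwy⟩ := ih hy
      refine ⟨MvPolynomial.coeff 0 u • w + ∑ i, MvPolynomial.coeff (Finsupp.single i 1) u •
        (wX K n i * w), Submodule.add_mem _ (Submodule.smul_mem _ _
          (monomialSpan_mono (Nat.le_succ b) hw)) (Submodule.sum_mem _ fun i _ =>
          Submodule.smul_mem _ _ (mul_mem_monomialSpan wX_mul_comm i hw)), fun m => ?_⟩
      conv_rhs => rw [eq_of_mem_affineForms hu]
      rw [add_smul, Finset.sum_smul, smul_assoc, hwy, AlgHom.toLinearMap_apply, map_add, map_sum,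
        add_mul, add_mul, Finset.sum_mul, Finset.sum_mul]
      congr 1
      · rw [← MvPolynomial.algebraMap_eq, AlgHom.commutes, Algebra.smul_def, mul_assoc]
      · refine Finset.sum_congr rfl fun i _ => ?_
        rw [smul_assoc, mul_smul, hwy, h.1, map_mul, ← MvPolynomial.algebraMap_eq,
          AlgHom.commutes, Algebra.smul_def, mul_assoc, mul_assoc]
    | add x y _ _ hx hy =>
      obtain ⟨v, hv, hvx⟩ := hx
      obtain ⟨w, hw, hwy⟩ := hy
      exact ⟨v + w, Submodule.add_mem _ hv hw, fun m => by rw [add_smul, hvx, hwy, add_mul]⟩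

theorem derivation_prod_map {D : Derivation K B B} {t : ℕ → B} {i : ℕ} {s : Multiset ℕ}
    (h : ∀ j ∈ s, D (t j) = if j = i then -(t j) ^ 2 else 0) :
    D (s.map t).prod = -((s.count i : B) * (t i * (s.map t).prod)) := by
  induction s using Multiset.induction_on with
  | empty => simp
  | cons j s ih =>
    rw [Multiset.map_cons, Multiset.prod_cons, D.leibniz,
      ih fun k hk => h k (Multiset.mem_cons_of_mem hk), h j (Multiset.mem_cons_self j s),
      Multiset.count_cons]
    by_cases hij : j = i
    · subst hij
      simp only [if_true, smul_eq_mul]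
      push_cast
      ring
    · rw [if_neg hij, if_neg (Ne.symm hij)]
      simp only [smul_eq_mul, mul_zero]
      push_cast
      ring

variable {ℓ : ℕ → MvPolynomial (Fin n) K} {t : ℕ → B} {r : ℕ}

theorem exists_derivation (h : ActsNaturally lam) (v : Fin n → K) :
    ∃ D : Derivation K B B, (∀ m, D m = ∑ i, v i • (wD K n i • m)) ∧
      ∀ u ∈ affineForms K n, D (lam u) = algebraMap K B (linPart K n u ⬝ᵥ v) := by
  choose δ hδ hδ2 using h.2
  have h1 : ∀ m, (∑ i, v i • δ i) m = ∑ i, v i • δ i m := fun m => by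
    have := congrFun (map_sum Derivation.coeFnAddMonoidHom (fun i => v i • δ i) Finset.univ) m
    rw [Finset.sum_apply] at this
    exact this
  refine ⟨∑ i, v i • δ i, fun m => ?_, fun u hu => ?_⟩
  · simp only [h1, hδ]
  · rw [h1, dotProduct, map_sum]
    refine Finset.sum_congr rfl fun i _ => ?_
    rw [hδ2, pderiv_of_mem_affineForms hu, ← MvPolynomial.algebraMap_eq, AlgHom.commutes,
      Algebra.smul_def, ← map_mul, mul_comm]

theorem exists_monomialSpan_wD_smul [CharZero K] [IsScalarTower K (Weyl K n) B]
    (h : ActsNaturally lam) (ht : ∀ i < r, t i * lam (ℓ i) = 1)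
    (hℓ : ∀ i < r, ℓ i ∈ affineForms K n) {S : Finset ℕ} (hS : S ∈ nbcSets K ℓ 1 r)
    (u : Multiset ℕ) (hu : ∀ i ∈ u, i ∈ S) :
    ∃ w ∈ monomialSpan (K := K) (wD K n) u.card,
      w • ((S.val.map t).prod : B) = ((u + S.val).map t).prod := by
  induction u using Multiset.induction_on with
  | empty => exact ⟨1, one_mem_monomialSpan _, by simp⟩
  | cons i u ih =>
    obtain ⟨w, hw, hwt⟩ := ih fun j hj => hu j (Multiset.mem_cons_of_mem hj)
    have hi := hu i (Multiset.mem_cons_self i u)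
    obtain ⟨v, hv⟩ := surjective_linPart_dotProduct hℓ hS (Pi.single ⟨i, hi⟩ 1)
    have hv' : ∀ j ∈ S, linPart K n (ℓ j) ⬝ᵥ v = if j = i then 1 else 0 := fun j hj => by
      have : linPart K n (ℓ j) ⬝ᵥ v = _ := congrFun hv ⟨j, hj⟩
      rw [this, Pi.single_apply]
      simp only [Subtype.mk.injEq]
    obtain ⟨D, hD, hDu⟩ := exists_derivation h v
    have hr : ∀ j ∈ S, j < r := fun j hj => Finset.mem_range.1 ((mem_nbcSets.1 hS).1 hj)
    have hDt : ∀ j ∈ u + S.val, D (t j) = if j = i then -(t j) ^ 2 else 0 := fun j hj => by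
      have hjS : j ∈ S := (Multiset.mem_add.1 hj).elim
        (fun hj => hu j (Multiset.mem_cons_of_mem hj)) id
      rw [D.leibniz_of_mul_eq_one (ht j (hr j hjS)), hDu _ (hℓ j (hr j hjS)), hv' j hjS]
      split_ifs <;> simp
    have hP := derivation_prod_map hDt
    have hc : ((u + S.val).count i : K) ≠ 0 := by
      rw [Nat.cast_ne_zero, ← Nat.pos_iff_ne_zero, Multiset.count_pos, Multiset.mem_add]
      exact Or.inr hi
    set c : K := ((u + S.val).count i : K) with hcdef
    refine ⟨-c⁻¹ • ∑ k, v k • (wD K n k * w), ?_, ?_⟩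
    · rw [Multiset.card_cons]
      exact Submodule.smul_mem _ _ (Submodule.sum_mem _ fun k _ =>
        Submodule.smul_mem _ _ (mul_mem_monomialSpan wD_mul_comm k hw))
    · have h1 : (∑ k, v k • (wD K n k * w)) • ((S.val.map t).prod : B) =
          D ((u + S.val).map t).prod := by
        rw [hD, Finset.sum_smul]
        refine Finset.sum_congr rfl fun k _ => ?_
        rw [smul_assoc, mul_smul, hwt]
      rw [smul_assoc, h1, hP, Multiset.cons_add, Multiset.map_cons, Multiset.prod_cons, smul_neg,
        neg_smul, neg_neg, ← map_natCast (algebraMap K B), ← Algebra.smul_def, smul_smul,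
        inv_mul_cancel₀ hc, one_smul]

theorem poleFilt_le_bernsteinSpan [CharZero K] [IsScalarTower K (Weyl K n) B]
    (h : ActsNaturally lam) (ht : ∀ i < r, t i * lam (ℓ i) = 1)
    (hℓ : ∀ i < r, ℓ i ∈ affineForms K n) (k : ℕ) :
    poleFilt ((affineForms K n).map lam.toLinearMap) t r k ≤
      bernsteinSpan K n k (poleFilt ((affineForms K n).map lam.toLinearMap) t r r) := by
  refine poleFilt_le fun s hs b hb x hx => ?_
  rw [← hb]
  refine prod_mul_mem_of_nbcSets (e := (1 : MvPolynomial (Fin n) K)) (ℓ := ℓ)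
    (G := fun k => bernsteinSpan K n k (poleFilt ((affineForms K n).map lam.toLinearMap) t r r))
    (E := fun _ => affineForms K n) (by simp) ht
    (fun j k hjk => bernsteinSpan_mono (by exact_mod_cast hjk) le_rfl) (fun _ _ => le_rfl)
    (fun _ _ => le_sup_left) ?_ s hs b hx
  intro s hs b x hx
  obtain ⟨w, hw, hwx⟩ := exists_monomialSpan_wX_smul h b hx
  have hle : s.toFinset.val ≤ s := Multiset.dedup_le s
  obtain ⟨v, hv, hvt⟩ := exists_monomialSpan_wD_smul h ht hℓ hs (s - s.toFinset.val)
    fun i hi => Multiset.mem_toFinset.2 (Multiset.mem_of_le (Multiset.sub_le_self _ _) hi)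
  rw [Multiset.sub_add_cancel hle] at hvt
  refine Submodule.subset_span ⟨w * v, bernsteinF_mono ?_ (mul_mem_bernsteinF hw hv),
    (s.toFinset.val.map t).prod, ?_, ?_⟩
  · have := Multiset.card_le_card (Multiset.sub_le_self s s.toFinset.val)
    omega
  · have h1 : (1 : Submodule K B) ≤ (affineForms K n).map lam.toLinearMap ⊔
        Submodule.span K (t '' Set.Iio r) := by
      rw [Submodule.one_le]
      exact Submodule.mem_sup_left ⟨1, one_mem_affineForms, by simp⟩
    have hsub := (mem_nbcSets.1 hs).1
    have hcard : s.toFinset.card ≤ r := by simpa using Finset.card_le_card hsub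
    have h2 : ((affineForms K n).map lam.toLinearMap ⊔
        Submodule.span K (t '' Set.Iio r)) ^ s.toFinset.card ≤ poleFilt _ t r r :=
      pow_le_pow_right' h1 hcard
    apply h2
    refine prod_map_mem_pow fun i hi => Submodule.mem_sup_right (Submodule.subset_span ?_)
    exact ⟨i, Finset.mem_range.1 (hsub hi), rfl⟩
  · rw [mul_smul, hvt, hwx, mul_comm]

end WeylAction

section PoleOrderFiltration
variable {K : Type} [Field K] {n : ℕ} {B : Type*} [CommRing B] [Algebra K B]
  {lam : MvPolynomial (Fin n) K →ₐ[K] B} {ℓ : ℕ → MvPolynomial (Fin n) K} {t : ℕ → B} {r : ℕ}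

theorem derivation_pow_mem {δ : Derivation K B B} {D : Submodule K B}
    (h : ∀ x ∈ D, δ x ∈ D ^ 2) (k : ℕ) {x : B} (hx : x ∈ D ^ k) : δ x ∈ D ^ (k + 1) := by
  induction k generalizing x with
  | zero =>
    rw [pow_zero, Submodule.mem_one] at hx
    obtain ⟨c, rfl⟩ := hx
    rw [δ.map_algebraMap]
    exact Submodule.zero_mem _
  | succ k ih =>
    rw [pow_succ'] at hx
    induction hx using Submodule.mul_induction_on' with
    | mem_mul_mem u hu y hy =>
      rw [δ.leibniz, smul_eq_mul, smul_eq_mul]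
      refine Submodule.add_mem _ ?_ ?_
      · rw [pow_succ']
        exact Submodule.mul_mem_mul hu (ih hy)
      · rw [add_assoc, pow_add]
        exact Submodule.mul_mem_mul hy (h u hu)
    | add x y _ _ hx hy => rw [map_add]; exact Submodule.add_mem _ hx hy

theorem one_le_sup_span :
    (1 : Submodule K B) ≤ (affineForms K n).map lam.toLinearMap ⊔
      Submodule.span K (t '' Set.Iio r) := by
  rw [Submodule.one_le]
  exact Submodule.mem_sup_left ⟨1, one_mem_affineForms, by simp⟩

theorem poleFilt_mono :
    Monotone fun k => poleFilt ((affineForms K n).map lam.toLinearMap) t r k :=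
  fun _ _ h => pow_le_pow_right' one_le_sup_span h

section
variable [Module (Weyl K n) B]

theorem wX_smul_mem_poleFilt (h : ActsNaturally lam) (i : Fin n) (k : ℕ) {m : B}
    (hm : m ∈ poleFilt ((affineForms K n).map lam.toLinearMap) t r k) :
    wX K n i • m ∈ poleFilt ((affineForms K n).map lam.toLinearMap) t r (k + 1) := by
  rw [h.1, poleFilt, pow_succ']
  refine Submodule.mul_mem_mul (Submodule.mem_sup_left ⟨MvPolynomial.X i, ?_, rfl⟩) hm
  exact (mem_restrictTotalDegree _ _ _).2 (MvPolynomial.totalDegree_X (R := K) i).le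

theorem wD_smul_mem_poleFilt (h : ActsNaturally lam) (ht : ∀ i < r, t i * lam (ℓ i) = 1)
    (hℓ : ∀ i < r, ℓ i ∈ affineForms K n) (i : Fin n) (k : ℕ) {m : B}
    (hm : m ∈ poleFilt ((affineForms K n).map lam.toLinearMap) t r k) :
    wD K n i • m ∈ poleFilt ((affineForms K n).map lam.toLinearMap) t r (k + 1) := by
  obtain ⟨δ, hδ, hδ2⟩ := h.2 i
  have hU : ∀ u ∈ affineForms K n, δ (lam u) = algebraMap K B (linPart K n u i) := fun u hu => by
    rw [hδ2, pderiv_of_mem_affineForms hu, ← MvPolynomial.algebraMap_eq, AlgHom.commutes]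
  rw [hδ]
  have hle : (affineForms K n).map lam.toLinearMap ⊔ Submodule.span K (t '' Set.Iio r) ≤
      (((affineForms K n).map lam.toLinearMap ⊔ Submodule.span K (t '' Set.Iio r)) ^ 2).comap
        (δ : B →ₗ[K] B) := by
    refine sup_le ?_ (Submodule.span_le.2 ?_)
    · rintro _ ⟨u, hu, rfl⟩
      rw [Submodule.mem_comap, AlgHom.toLinearMap_apply, Derivation.coeFn_coe, hU u hu,
        Algebra.algebraMap_eq_smul_one]
      exact Submodule.smul_mem _ _ (Submodule.one_le.1 (one_le_pow_of_one_le' one_le_sup_span 2))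
    · rintro _ ⟨j, hj, rfl⟩
      rw [SetLike.mem_coe, Submodule.mem_comap, Derivation.coeFn_coe,
        δ.leibniz_of_mul_eq_one (ht j hj), hU _ (hℓ j hj), Algebra.algebraMap_eq_smul_one,
        smul_comm, neg_smul, smul_eq_mul, mul_one]
      refine Submodule.smul_mem _ _ (Submodule.neg_mem _ ?_)
      have : t j ∈ (affineForms K n).map lam.toLinearMap ⊔ Submodule.span K (t '' Set.Iio r) :=
        Submodule.mem_sup_right (Submodule.subset_span ⟨j, hj, rfl⟩)
      exact Submodule.pow_mem_pow _ this 2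
  exact derivation_pow_mem (fun x hx => hle hx) k hm

end

theorem restrictTotalDegree_le_pow (k : ℕ) :
    restrictTotalDegree (Fin n) K k ≤ affineForms K n ^ k := by
  intro p hp
  rw [p.as_sum]
  refine Submodule.sum_mem _ fun m hm => ?_
  rw [MvPolynomial.monomial_eq, ← MvPolynomial.smul_eq_C_mul]
  refine Submodule.smul_mem _ _ ?_
  have h1 : (1 : Submodule K (MvPolynomial (Fin n) K)) ≤ affineForms K n :=
    Submodule.one_le.2 one_mem_affineForms
  have h2 : (m.sum fun _ e => e) ≤ k :=
    (MvPolynomial.le_totalDegree hm).trans ((mem_restrictTotalDegree _ _ _).1 hp)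
  refine pow_le_pow_right' h1 h2 ?_
  rw [Finsupp.prod, Finsupp.sum]
  induction m.support using Finset.induction_on with
  | empty => simpa using Submodule.one_le.1 (le_refl (1 : Submodule K (MvPolynomial (Fin n) K)))
  | insert i s hi ih =>
    rw [Finset.prod_insert hi, Finset.sum_insert hi, pow_add]
    refine Submodule.mul_mem_mul (Submodule.pow_mem_pow _ ?_ _) ih
    exact (mem_restrictTotalDegree _ _ _).2 (MvPolynomial.totalDegree_X (R := K) i).le

theorem finrank_restrictTotalDegree_le (k : ℕ) :
    Module.finrank K (restrictTotalDegree (Fin n) K k) ≤ (n + k).choose k := by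
  classical
  have hfd : FiniteDimensional K (affineForms K n) := by
    have := finiteDimensional_map_affineForms le_rfl
      (LinearMap.id : MvPolynomial (Fin n) K →ₗ[K] MvPolynomial (Fin n) K)
    rwa [Submodule.map_id] at this
  let b := Module.finBasis K (affineForms K n)
  have hspan : Submodule.span K ((Finset.univ.image fun i => (b i : MvPolynomial (Fin n) K) :
      Finset _) : Set (MvPolynomial (Fin n) K)) = affineForms K n := by
    rw [Finset.coe_image, Finset.coe_univ, Set.image_univ]
    have h3 := congrArg (Submodule.map (affineForms K n).subtype) b.span_eq
    rw [Submodule.map_span, Submodule.map_top, Submodule.range_subtype, ← Set.range_comp] at h3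
    exact h3
  have := finiteDimensional_pow (affineForms K n) k
  refine (Submodule.finrank_mono (restrictTotalDegree_le_pow k)).trans ?_
  have h1 := finrank_span_finset_pow_le (K := K)
    (Finset.univ.image fun i => (b i : MvPolynomial (Fin n) K)) k
  rw [hspan] at h1
  refine h1.trans (Nat.choose_le_choose k ?_)
  have h4 := Finset.card_image_le (s := Finset.univ)
    (f := fun i => (b i : MvPolynomial (Fin n) K))
  rw [Finset.card_univ, Fintype.card_fin] at h4
  have h5 := finrank_affineForms (K := K) (n := n)
  omega

theorem totalDegree_le_of_mem_poleFilt (hinj : Function.Injective lam)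
    (ht : ∀ i < r, t i * lam (ℓ i) = 1) (hℓ : ∀ i < r, (ℓ i).totalDegree = 1) {k : ℕ}
    {p : MvPolynomial (Fin n) K}
    (hp : lam p ∈ poleFilt ((affineForms K n).map lam.toLinearMap) t r k) :
    p.totalDegree ≤ k := by
  set f := ∏ i ∈ Finset.range r, ℓ i with hf
  have hne : ∀ i < r, ℓ i ≠ 0 := fun i hi h => by simpa [h] using hℓ i hi
  have hprod : ∀ s ⊆ Finset.range r, (∏ i ∈ s, ℓ i).totalDegree = s.card := fun s hs => by
    induction s using Finset.induction_on with
    | empty => simp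
    | insert i s hi ih =>
      have hs' := (Finset.subset_insert i s).trans hs
      have hir := Finset.mem_range.1 (hs (Finset.mem_insert_self i s))
      rw [Finset.prod_insert hi, MvPolynomial.totalDegree_mul_of_isDomain (hne i hir)
        (Finset.prod_ne_zero_iff.2 fun j hj => hne j (Finset.mem_range.1 (hs' hj))), ih hs',
        hℓ i hir, Finset.card_insert_of_notMem hi, add_comm]
  have hfd : f.totalDegree = r := by rw [hprod _ subset_rfl, Finset.card_range]
  have hf0 : f ≠ 0 := Finset.prod_ne_zero_iff.2 fun i hi => hne i (Finset.mem_range.1 hi)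
  have hD : ∀ x ∈ (affineForms K n).map lam.toLinearMap ⊔ Submodule.span K (t '' Set.Iio r),
      lam f * x ∈ (restrictTotalDegree (Fin n) K (1 + r)).map lam.toLinearMap := by
    have : (affineForms K n).map lam.toLinearMap ⊔ Submodule.span K (t '' Set.Iio r) ≤
        ((restrictTotalDegree (Fin n) K (1 + r)).map lam.toLinearMap).comap
          (LinearMap.mulLeft K (lam f)) := by
      refine sup_le ?_ (Submodule.span_le.2 ?_)
      · rintro _ ⟨u, hu, rfl⟩
        refine ⟨f * u, (mem_restrictTotalDegree _ _ _).2 ?_, by simp⟩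
        refine (MvPolynomial.totalDegree_mul _ _).trans ?_
        have := (mem_restrictTotalDegree _ _ _).1 hu
        omega
      · rintro _ ⟨i, hi, rfl⟩
        refine ⟨∏ j ∈ (Finset.range r).erase i, ℓ j, (mem_restrictTotalDegree _ _ _).2 ?_, ?_⟩
        · rw [hprod _ (Finset.erase_subset _ _)]
          have := Finset.card_erase_le (s := Finset.range r) (a := i)
          rw [Finset.card_range] at this
          omega
        · rw [LinearMap.mulLeft_apply, AlgHom.toLinearMap_apply, hf,
            ← Finset.mul_prod_erase _ _ (Finset.mem_range.2 hi), map_mul, mul_right_comm,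
            mul_comm (lam (ℓ i)), ht i hi, one_mul]
    exact fun x hx => this hx
  have hDk : ∀ k, ∀ x ∈ poleFilt ((affineForms K n).map lam.toLinearMap) t r k,
      lam f ^ k * x ∈ (restrictTotalDegree (Fin n) K (k + k * r)).map lam.toLinearMap := by
    intro k
    induction k with
    | zero =>
      intro x hx
      rw [poleFilt, pow_zero, Submodule.mem_one] at hx
      obtain ⟨c, rfl⟩ := hx
      exact ⟨MvPolynomial.C c, (mem_restrictTotalDegree _ _ _).2 (by simp), by
        simp [← MvPolynomial.algebraMap_eq]⟩
    | succ k ih =>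
      intro x hx
      rw [poleFilt, pow_succ'] at hx
      induction hx using Submodule.mul_induction_on' with
      | mem_mul_mem u hu y hy =>
        obtain ⟨a, ha, hau⟩ := hD u hu
        obtain ⟨b, hb, hby⟩ := ih y hy
        refine ⟨a * b, (mem_restrictTotalDegree _ _ _).2 ?_, ?_⟩
        · refine (MvPolynomial.totalDegree_mul _ _).trans ?_
          have h1 := (mem_restrictTotalDegree _ _ _).1 ha
          have h2 := (mem_restrictTotalDegree _ _ _).1 hb
          nlinarith
        · rw [AlgHom.toLinearMap_apply] at hau hby ⊢
          rw [map_mul, hau, hby]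
          ring
      | add x y _ _ hx hy => rw [mul_add]; exact Submodule.add_mem _ hx hy
  by_cases hp0 : p = 0
  · simp [hp0]
  obtain ⟨q, hq, hqp⟩ := hDk k _ hp
  rw [AlgHom.toLinearMap_apply, ← map_pow, ← map_mul] at hqp
  have hpow : ∀ k, (f ^ k).totalDegree = k * r := fun k => by
    induction k with
    | zero => simp
    | succ k ih =>
      rw [pow_succ, MvPolynomial.totalDegree_mul_of_isDomain (pow_ne_zero _ hf0) hf0, ih, hfd,
        Nat.succ_mul]
  have h1 := (mem_restrictTotalDegree _ _ _).1 hq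
  rw [hinj hqp, MvPolynomial.totalDegree_mul_of_isDomain (pow_ne_zero _ hf0) hp0, hpow] at h1
  omega

end PoleOrderFiltration

section LowerBound
variable {K : Type} [Field K] {n : ℕ} {B : Type*} [CommRing B] [Algebra K B]
  {lam : MvPolynomial (Fin n) K →ₐ[K] B} {ℓ : ℕ → MvPolynomial (Fin n) K} {t : ℕ → B} {r : ℕ}

theorem finrank_poleFilt_le_add {M : Type*} [AddCommGroup M] [Module K M] (q : B →ₗ[K] M)
    (hq : ∀ x, q x = 0 → x ∈ Set.range lam) (hinj : Function.Injective lam)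
    (ht : ∀ i < r, t i * lam (ℓ i) = 1) (hℓ : ∀ i < r, (ℓ i).totalDegree = 1) (k : ℕ) :
    Module.finrank K (poleFilt ((affineForms K n).map lam.toLinearMap) t r k) ≤
      Module.finrank K ((poleFilt ((affineForms K n).map lam.toLinearMap) t r k).map q) +
        (n + k).choose k := by
  set P := poleFilt ((affineForms K n).map lam.toLinearMap) t r k with hP
  have hfd := finiteDimensional_map_affineForms (K := K) (n := n) le_rfl lam.toLinearMap
  have hPfd : FiniteDimensional K P := finiteDimensional_poleFilt _ t r k
  have hRfd : FiniteDimensional K (restrictTotalDegree (Fin n) K k) := by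
    have := finiteDimensional_map_affineForms (K := K) (n := n) le_rfl LinearMap.id
    rw [Submodule.map_id] at this
    have := finiteDimensional_pow (affineForms K n) k
    exact Submodule.finiteDimensional_of_le (restrictTotalDegree_le_pow k)
  have h1 := LinearMap.finrank_range_add_finrank_ker (q.domRestrict P)
  rw [LinearMap.range_domRestrict] at h1
  have h2 : (LinearMap.ker (q.domRestrict P)).map P.subtype ≤
      (restrictTotalDegree (Fin n) K k).map lam.toLinearMap := by
    rintro _ ⟨x, hx, rfl⟩
    obtain ⟨p, hp⟩ := hq _ (LinearMap.mem_ker.1 hx)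
    refine ⟨p, (mem_restrictTotalDegree _ _ _).2 ?_, hp⟩
    refine totalDegree_le_of_mem_poleFilt hinj ht hℓ ?_
    rw [hp]
    exact x.2
  have h3 := Submodule.finrank_mono h2
  rw [← (Submodule.equivMapOfInjective P.subtype P.subtype_injective _).finrank_eq] at h3
  have h4 := (Submodule.finrank_map_le lam.toLinearMap (restrictTotalDegree (Fin n) K k)).trans
    (finrank_restrictTotalDegree_le k)
  omega

theorem card_nbcSets_mul_choose_le (χ : B →ₐ[K] FractionRing (MvPolynomial (Fin n) K))
    (hχl : χ.comp lam = toRat K n)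
    (ht : ∀ i < r, t i * lam (ℓ i) = 1) (hℓ : ∀ i < r, ℓ i ∈ affineForms K n) (k : ℕ)
    (hk : r ≤ k) : (nbcSets K ℓ 1 r).card * (k - r + n).choose n ≤
      Module.finrank K (poleFilt ((affineForms K n).map lam.toLinearMap) t r k) := by
  have h1 := card_nbcSets_mul_choose_le_finrank_poleFilt r n (affineForms K n) le_rfl
    one_mem_affineForms finrank_affineForms ℓ hℓ k hk
  have h2 : (affineForms K n).map (toRat K n).toLinearMap =
      ((affineForms K n).map lam.toLinearMap).map χ.toLinearMap := by
    rw [← hχl, AlgHom.comp_toLinearMap, Submodule.map_comp]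
  have h3 : ∀ i < r, (toRat K n (ℓ i))⁻¹ = (χ ∘ t) i := fun i hi => by
    have := congrArg χ (ht i hi)
    rw [map_mul, map_one] at this
    rw [← hχl]
    exact inv_eq_of_mul_eq_one_left this
  rw [poleFilt_congr _ h3, h2, ← map_poleFilt] at h1
  have hfd := finiteDimensional_map_affineForms (K := K) (n := n) le_rfl lam.toLinearMap
  have hPfd := finiteDimensional_poleFilt ((affineForms K n).map lam.toLinearMap) t r k
  exact h1.trans (Submodule.finrank_map_le _ _)

theorem exists_mem_poleFilt (ht : ∀ i < r, t i * lam (ℓ i) = 1)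
    (hloc : ∀ y : B, ∃ p e, y * lam (∏ i ∈ Finset.range r, ℓ i) ^ e = lam p) (y : B) :
    ∃ k, y ∈ poleFilt ((affineForms K n).map lam.toLinearMap) t r k := by
  obtain ⟨p, e, hy⟩ := hloc y
  have h1 : (∏ i ∈ Finset.range r, t i) * lam (∏ i ∈ Finset.range r, ℓ i) = 1 := by
    rw [map_prod, ← Finset.prod_mul_distrib]
    exact Finset.prod_eq_one fun i hi => ht i (Finset.mem_range.1 hi)
  have h2 : y = (∏ i ∈ Finset.range r, t i) ^ e * lam p := by
    rw [← hy, mul_comm, mul_assoc, ← mul_pow, mul_comm (lam _), h1, one_pow, mul_one]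
  have h3 : lam p ∈ ((affineForms K n).map lam.toLinearMap ⊔
      Submodule.span K (t '' Set.Iio r)) ^ p.totalDegree := by
    have h4 := restrictTotalDegree_le_pow p.totalDegree
      ((mem_restrictTotalDegree _ _ p).2 le_rfl)
    have h5 : ((affineForms K n) ^ p.totalDegree).map lam.toLinearMap ≤
        ((affineForms K n).map lam.toLinearMap ⊔
          Submodule.span K (t '' Set.Iio r)) ^ p.totalDegree := by
      rw [Submodule.map_pow]
      exact pow_le_pow_left' le_sup_left _
    exact h5 ⟨p, h4, rfl⟩
  refine ⟨r * e + p.totalDegree, ?_⟩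
  rw [h2, poleFilt, pow_add, pow_mul]
  refine Submodule.mul_mem_mul (Submodule.pow_mem_pow _ ?_ e) h3
  have := prod_map_mem_pow (K := K) (t := t) (s := Multiset.range r)
    (D := (affineForms K n).map lam.toLinearMap ⊔ Submodule.span K (t '' Set.Iio r))
    fun i hi => Submodule.mem_sup_right
      (Submodule.subset_span ⟨i, Multiset.mem_range.1 hi, rfl⟩)
  rwa [Multiset.card_range] at this

end LowerBound

section Asymptotics

theorem leadingCoeff_sub_nonneg_of_eventually_le {p q : Polynomial ℚ}
    (h : ∀ᶠ j : ℕ in Filter.atTop, p.eval (j : ℚ) ≤ q.eval (j : ℚ)) :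
    0 ≤ (q - p).leadingCoeff := by
  by_contra! hlt
  have hev : ∀ᶠ j : ℕ in Filter.atTop, 0 ≤ (q - p).eval (j : ℚ) := by
    filter_upwards [h] with j hj
    rw [Polynomial.eval_sub]
    linarith
  rcases Nat.eq_zero_or_pos (q - p).natDegree with h0 | h0
  · obtain ⟨j, hj⟩ := hev.exists
    rw [Polynomial.eq_C_of_natDegree_eq_zero h0] at hj hlt
    rw [Polynomial.eval_C] at hj
    rw [Polynomial.leadingCoeff_C] at hlt
    linarith
  · have ht := (Polynomial.tendsto_atBot_of_leadingCoeff_nonpos (q - p)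
      (Polynomial.natDegree_pos_iff_degree_pos.1 h0) hlt.le).comp
      (tendsto_natCast_atTop_atTop (R := ℚ))
    obtain ⟨j, hj, hj'⟩ := (hev.and (ht.eventually_lt_atBot 0)).exists
    exact absurd hj' (not_lt.2 hj)

theorem coeff_nonneg_of_leadingCoeff_nonneg {p : Polynomial ℚ} {n : ℕ} (h : 0 ≤ p.leadingCoeff)
    (hn : p.natDegree ≤ n) : 0 ≤ p.coeff n := by
  rcases hn.lt_or_eq with hlt | rfl
  · rw [Polynomial.coeff_eq_zero_of_natDegree_lt hlt]
  · exact h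

/-- The polynomial whose value at `x` is the binomial coefficient of `x + c + n` and `n`. -/
noncomputable def choosePoly (n : ℕ) (c : ℚ) : Polynomial ℚ :=
  Polynomial.C ((n.factorial : ℚ)⁻¹) *
    (ascPochhammer ℚ n).comp (Polynomial.X + Polynomial.C (c + 1))

theorem eval_choosePoly {n m : ℕ} {c x : ℚ} (h : x + c = m) :
    (choosePoly n c).eval x = (m + n).choose n := by
  have h1 : x + (c + 1) = ((m + 1 : ℕ) : ℚ) := by push_cast; rw [← h]; ring
  rw [choosePoly, Polynomial.eval_mul, Polynomial.eval_C, Polynomial.eval_comp,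
    Polynomial.eval_add, Polynomial.eval_X, Polynomial.eval_C, h1, ← ascPochhammer_eval_cast,
    ascPochhammer_nat_eq_ascFactorial, Nat.ascFactorial_eq_factorial_mul_choose, Nat.cast_mul,
    ← mul_assoc, inv_mul_cancel₀ (by exact_mod_cast n.factorial_ne_zero), one_mul]

theorem natDegree_choosePoly_le (n : ℕ) (c : ℚ) : (choosePoly n c).natDegree ≤ n := by
  refine (Polynomial.natDegree_C_mul_le _ _).trans ?_
  rw [Polynomial.natDegree_comp, Polynomial.natDegree_X_add_C, mul_one, ascPochhammer_natDegree]

theorem coeff_choosePoly (n : ℕ) (c : ℚ) :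
    (choosePoly n c).coeff n = (n.factorial : ℚ)⁻¹ := by
  have hm := (monic_ascPochhammer ℚ n).comp_X_add_C (c + 1)
  have hd : ((ascPochhammer ℚ n).comp (Polynomial.X + Polynomial.C (c + 1))).natDegree = n := by
    rw [Polynomial.natDegree_comp, Polynomial.natDegree_X_add_C, mul_one, ascPochhammer_natDegree]
  have := hm.coeff_natDegree
  rw [hd] at this
  rw [choosePoly, Polynomial.coeff_C_mul, this, mul_one]

theorem factorial_mul_leadingCoeff_eq {n N a b : ℕ} (hN : 1 ≤ N) {h : Polynomial ℚ}
    (hpos : ∀ᶠ j : ℕ in Filter.atTop, 0 ≤ h.eval (j : ℚ))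
    (hup : ∀ᶠ j : ℕ in Filter.atTop,
      h.eval (j : ℚ) ≤ ((N : ℚ) - 1) * ((j + a + n).choose n : ℕ))
    (hlow : ∀ᶠ j : ℕ in Filter.atTop,
      (N : ℚ) * ((j - b + n).choose n : ℕ) - ((j + n).choose n : ℕ) ≤ h.eval (j : ℚ)) :
    (h.natDegree.factorial : ℚ) * h.leadingCoeff = N - 1 := by
  set g₁ : Polynomial ℚ := Polynomial.C ((N : ℚ) - 1) * choosePoly n a with hg₁
  set g₂ : Polynomial ℚ := Polynomial.C (N : ℚ) * choosePoly n (-b) - choosePoly n 0 with hg₂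
  have h1 : 0 ≤ (g₁ - h).leadingCoeff := by
    refine leadingCoeff_sub_nonneg_of_eventually_le ?_
    filter_upwards [hup] with j hj
    rw [hg₁, Polynomial.eval_mul, Polynomial.eval_C,
      eval_choosePoly (m := j + a) (by push_cast; ring)]
    exact hj
  have h2 : 0 ≤ (h - g₂).leadingCoeff := by
    refine leadingCoeff_sub_nonneg_of_eventually_le ?_
    filter_upwards [hlow, Filter.eventually_ge_atTop b] with j hj hjb
    rw [hg₂, Polynomial.eval_sub, Polynomial.eval_mul, Polynomial.eval_C,
      eval_choosePoly (m := j - b) (by rw [Nat.cast_sub hjb]; ring),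
      eval_choosePoly (m := j) (by ring)]
    exact hj
  have h3 : 0 ≤ h.leadingCoeff := by
    have := leadingCoeff_sub_nonneg_of_eventually_le (p := 0) (q := h) (by simpa using hpos)
    rwa [sub_zero] at this
  have hd₁ : g₁.natDegree ≤ n :=
    (Polynomial.natDegree_C_mul_le _ _).trans (natDegree_choosePoly_le _ _)
  have hd₂ : g₂.natDegree ≤ n :=
    (Polynomial.natDegree_sub_le_of_le ((Polynomial.natDegree_C_mul_le _ _).trans
      (natDegree_choosePoly_le _ _)) (natDegree_choosePoly_le _ _)).trans (max_self n).le
  have hc₁ : g₁.coeff n = ((N : ℚ) - 1) * (n.factorial : ℚ)⁻¹ := by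
    rw [hg₁, Polynomial.coeff_C_mul, coeff_choosePoly]
  have hc₂ : g₂.coeff n = ((N : ℚ) - 1) * (n.factorial : ℚ)⁻¹ := by
    rw [hg₂, Polynomial.coeff_sub, Polynomial.coeff_C_mul, coeff_choosePoly, coeff_choosePoly]
    ring
  have hfac : (n.factorial : ℚ) ≠ 0 := by exact_mod_cast n.factorial_ne_zero
  have hd : h.natDegree ≤ n := by
    by_contra! hlt
    have : (g₁ - h).leadingCoeff = -h.leadingCoeff :=
      Polynomial.leadingCoeff_sub_of_degree_lt'
        (Polynomial.degree_lt_degree (hd₁.trans_lt hlt))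
    have h0 : h.leadingCoeff = 0 := by linarith
    rw [Polynomial.leadingCoeff_eq_zero.1 h0, Polynomial.natDegree_zero] at hlt
    omega
  have hcn : h.coeff n = ((N : ℚ) - 1) * (n.factorial : ℚ)⁻¹ := by
    have h4 := coeff_nonneg_of_leadingCoeff_nonneg h1
      ((Polynomial.natDegree_sub_le_of_le hd₁ hd).trans (max_self n).le)
    have h5 := coeff_nonneg_of_leadingCoeff_nonneg h2
      ((Polynomial.natDegree_sub_le_of_le hd hd₂).trans (max_self n).le)
    rw [Polynomial.coeff_sub, hc₁] at h4
    rw [Polynomial.coeff_sub, hc₂] at h5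
    linarith
  rcases hN.eq_or_lt with rfl | hN
  · have : g₁ = 0 := by simp [hg₁]
    rw [this, zero_sub, Polynomial.leadingCoeff_neg] at h1
    rw [le_antisymm (by linarith) h3]
    simp
  · have hne : h.coeff n ≠ 0 := by
      rw [hcn]
      refine mul_ne_zero (sub_ne_zero.2 ?_) (inv_ne_zero hfac)
      exact_mod_cast hN.ne'
    have hdn : h.natDegree = n := hd.antisymm (Polynomial.le_natDegree_of_ne_zero hne)
    rw [Polynomial.leadingCoeff, hdn, hcn, mul_left_comm, mul_inv_cancel₀ hfac, mul_one]

end Asymptotics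

section GoodFiltrations
variable {K : Type} [Field K] {n : ℕ}

theorem exists_le_of_finiteDimensional {M ι : Type*} [AddCommGroup M] [Module K M] [LinearOrder ι]
    [Nonempty ι] {F : ι → Submodule K M} (hF : Monotone F) (hex : ∀ m, ∃ k, m ∈ F k)
    (W : Submodule K M) [hW : FiniteDimensional K W] : ∃ k, W ≤ F k := by
  obtain ⟨S, rfl⟩ := Module.Finite.iff_fg.1 hW
  choose k hk using hex
  obtain ⟨b, hb⟩ := (S.image k).exists_le
  refine ⟨b, Submodule.span_le.2 fun m hm => hF (hb _ ?_) (hk m)⟩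
  exact Finset.mem_image_of_mem k hm

theorem GoodFiltration.eval_bounds {M : Type} [AddCommGroup M] [Module K M] [Module (Weyl K n) M]
    [IsScalarTower K (Weyl K n) M] {F : ℤ → Submodule K M} (hF : GoodFiltration K n M F)
    {P : ℕ → Submodule K M} [hPfd : ∀ k, FiniteDimensional K (P k)] (hP : Monotone P)
    (hPex : ∀ m, ∃ k, m ∈ P k)
    (hX : ∀ i k, ∀ m ∈ P k, wX K n i • m ∈ P (k + 1))
    (hD : ∀ i k, ∀ m ∈ P k, wD K n i • m ∈ P (k + 1)) {r : ℕ}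
    (hgen : ∀ k : ℕ, P k ≤ bernsteinSpan K n k (P r)) :
    ∃ a b : ℕ, ∀ᶠ j : ℕ in Filter.atTop, P (j - b) ≤ F j ∧ F j ≤ P (j + a) := by
  have hFm : Monotone F := monotone_int_of_le_succ hF.mono
  obtain ⟨k₁, hk₁⟩ := hF.good
  have := hF.finiteDim
  obtain ⟨c, hc⟩ := exists_le_of_finiteDimensional hP hPex (F k₁)
  obtain ⟨d, hd⟩ := exists_le_of_finiteDimensional hFm hF.exhaustive (P r)
  refine ⟨k₁.natAbs + c, d.natAbs, ?_⟩
  filter_upwards [Filter.eventually_ge_atTop (k₁.natAbs + d.natAbs)] with j hj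
  constructor
  · refine (hgen _).trans (Submodule.span_le.2 ?_)
    rintro _ ⟨w, hw, v, hv, rfl⟩
    exact hFm (by omega) (hF.compat _ _ w hw v (hd hv))
  · have h1 := hk₁ k₁ le_rfl (j - k₁) (by omega)
    rw [sub_add_cancel] at h1
    refine h1.trans (Submodule.span_le.2 ?_)
    rintro _ ⟨w, hw, v, hv, rfl⟩
    exact bernsteinF_smul_mem hP hX hD (by omega) hw (hc hv)

end GoodFiltrations

section Multiplicity
variable {K : Type} [Field K] [CharZero K] {n : ℕ} {B M : Type} [CommRing B] [Algebra K B]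
  [Module (Weyl K n) B] [IsScalarTower K (Weyl K n) B] [AddCommGroup M] [Module K M]
  [Module (Weyl K n) M] [IsScalarTower K (Weyl K n) M]
  {lam : MvPolynomial (Fin n) K →ₐ[K] B} {ℓ : ℕ → MvPolynomial (Fin n) K} {t : ℕ → B} {r : ℕ}

theorem eq_card_nbcSets_sub_one_of_hasMult (hlam : ActsNaturally lam)
    (hinj : Function.Injective lam) (χ : B →ₐ[K] FractionRing (MvPolynomial (Fin n) K))
    (hχ : χ.comp lam = toRat K n) (ht : ∀ i < r, t i * lam (ℓ i) = 1)
    (hℓ : ∀ i < r, (ℓ i).totalDegree = 1)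
    (hloc : ∀ y : B, ∃ p e, y * lam (∏ i ∈ Finset.range r, ℓ i) ^ e = lam p)
    (q : B →ₗ[Weyl K n] M) (hqs : Function.Surjective q)
    (hq : ∀ x, q x = 0 ↔ x ∈ Set.range lam) {m : ℚ} (hm : HasMult K n M m) :
    m = (nbcSets K ℓ 1 r).card - 1 := by
  obtain ⟨F, hF, h, ⟨N₀, hN₀⟩, rfl⟩ := hm
  have hℓ1 : ∀ i < r, ℓ i ∈ affineForms K n := fun i hi =>
    (mem_restrictTotalDegree _ _ _).2 (hℓ i hi).le
  let q' : B →ₗ[K] M := q.restrictScalars K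
  let P : ℕ → Submodule K B := fun k => poleFilt ((affineForms K n).map lam.toLinearMap) t r k
  have hUfd : FiniteDimensional K (affineForms K n) := by
    have := finiteDimensional_map_affineForms (K := K) (n := n) le_rfl LinearMap.id
    rwa [Submodule.map_id] at this
  have hPfd : ∀ k, FiniteDimensional K (P k) := fun k => finiteDimensional_poleFilt _ t r k
  have hPm : Monotone P := poleFilt_mono
  have hPX : ∀ i k, ∀ x ∈ (P k).map q', wX K n i • x ∈ (P (k + 1)).map q' := by
    rintro i k _ ⟨x, hx, rfl⟩
    exact ⟨_, wX_smul_mem_poleFilt hlam i k hx, map_smul q _ _⟩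
  have hPD : ∀ i k, ∀ x ∈ (P k).map q', wD K n i • x ∈ (P (k + 1)).map q' := by
    rintro i k _ ⟨x, hx, rfl⟩
    exact ⟨_, wD_smul_mem_poleFilt hlam ht hℓ1 i k hx, map_smul q _ _⟩
  have hgen : ∀ k : ℕ, (P k).map q' ≤ bernsteinSpan K n k ((P r).map q') := by
    intro k
    rw [Submodule.map_le_iff_le_comap]
    refine (poleFilt_le_bernsteinSpan hlam ht hℓ1 k).trans (Submodule.span_le.2 ?_)
    rintro _ ⟨w, hw, v, hv, rfl⟩
    exact Submodule.subset_span ⟨w, hw, q' v, ⟨v, hv, rfl⟩, map_smul q _ _⟩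
  obtain ⟨a, b, hab⟩ := hF.eval_bounds (P := fun k => (P k).map q')
    (fun i j hij => Submodule.map_mono (hPm hij))
    (fun x => by
      obtain ⟨y, rfl⟩ := hqs x
      obtain ⟨k, hk⟩ := exists_mem_poleFilt ht hloc y
      exact ⟨k, y, hk, rfl⟩) hPX hPD hgen
  have h0 : ∅ ∈ nbcSets K ℓ (1 : MvPolynomial (Fin n) K) r :=
    empty_mem_nbcSets one_ne_zero fun i hi h => by simpa [h] using hℓ i hi
  have hcard : 1 ≤ (nbcSets K ℓ (1 : MvPolynomial (Fin n) K) r).card :=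
    Finset.card_pos.2 ⟨_, h0⟩
  have hFfd := hF.finiteDim
  have hev : ∀ᶠ j : ℕ in Filter.atTop,
      (Module.finrank K (F j) : ℚ) = h.eval (j : ℚ) := by
    filter_upwards [Filter.eventually_ge_atTop N₀.toNat] with j hj
    have := hN₀ j (by omega)
    exact_mod_cast this
  refine factorial_mul_leadingCoeff_eq (n := n) (a := a) (b := b + r) hcard ?_ ?_ ?_
  · filter_upwards [hev] with j hj
    rw [← hj]
    positivity
  · filter_upwards [hev, hab] with j hj hab
    have h1 := finrank_map_poleFilt_le q' (lam := lam.toLinearMap)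
      (e := (1 : MvPolynomial (Fin n) K)) one_ne_zero (map_one lam) ht h0 finrank_affineForms
      one_mem_affineForms hℓ1 (fun b x hx => ?_) (j + a)
    · have h2 := (Submodule.finrank_mono hab.2).trans h1
      rw [Nat.choose_symm_add.symm, add_comm n] at h2
      rw [← hj, ← Nat.cast_pred (R := ℚ) hcard]
      exact_mod_cast h2
    · rw [← Submodule.map_pow] at hx
      obtain ⟨p, -, rfl⟩ := hx
      exact (hq _).2 ⟨p, rfl⟩
  · filter_upwards [hev, hab, Filter.eventually_ge_atTop (b + r)] with j hj hab hjb
    have h1 := card_nbcSets_mul_choose_le χ hχ ht hℓ1 (j - b) (by omega)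
    have h2 := finrank_poleFilt_le_add q' (fun x hx => (hq x).1 hx) hinj ht hℓ (j - b)
    have h3 := Submodule.finrank_mono hab.1
    have h4 : (n + (j - b)).choose (j - b) ≤ (j + n).choose n := by
      rw [Nat.choose_symm_add.symm, add_comm n]
      exact Nat.choose_le_choose n (by omega)
    rw [← hj, sub_le_iff_le_add, Nat.sub_add_eq]
    exact_mod_cast h1.trans (h2.trans (add_le_add h3 h4))

end Multiplicity

theorem notMem_span_one_of_totalDegree {K : Type} [Field K] {n : ℕ}
    {p : MvPolynomial (Fin n) K} (hp : p.totalDegree = 1) : p ∉ Submodule.span K {1} := by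
  intro h
  obtain ⟨c, rfl⟩ := Submodule.mem_span_singleton.1 h
  rw [← MvPolynomial.C_1, MvPolynomial.smul_eq_C_mul, ← MvPolynomial.C_mul,
    totalDegree_C] at hp
  exact zero_ne_one hp

theorem exists_enumeration {α : Type} [Zero α] [DecidableEq α] (A : Finset α) :
    ∃ ℓ : ℕ → α, A = (Finset.range A.card).image ℓ ∧ Set.InjOn ℓ (Finset.range A.card) := by
  refine ⟨fun i => if h : i < A.card then (A.equivFin.symm ⟨i, h⟩ : α) else 0, ?_, ?_⟩
  · ext x
    simp only [Finset.mem_image, Finset.mem_range]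
    constructor
    · intro hx
      exact ⟨A.equivFin ⟨x, hx⟩, (A.equivFin ⟨x, hx⟩).2, by simp⟩
    · rintro ⟨i, hi, rfl⟩
      simp [hi]
  · intro i hi j hj hij
    simp only [Finset.coe_range, Set.mem_Iio] at hi hj
    simpa [hi, hj, Subtype.ext_iff] using hij

open scoped Classical in
/-- For a hyperplane arrangement `𝒜` in `K^n` defined by a
squarefree product `f` of degree-one polynomials, the multiplicity of the
holonomic left `D_n`-module `H¹_{(f)}(R)` (with respect to the Bernstein
filtration) equals `π(𝒜,1) − 1`. -/
theorem mult_H1_eq_poincare_sub_one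
    (K : Type) [Field K] [CharZero K] (n : ℕ)
    (A : Finset (MvPolynomial (Fin n) K)) (f : MvPolynomial (Fin n) K)
    (hf : f = ∏ p ∈ A, p) (hsf : Squarefree f)
    (hdeg : ∀ p ∈ A, p.totalDegree = 1)
    [Module (Weyl K n) (Localization.Away f)]
    [IsScalarTower K (Weyl K n) (Localization.Away f)]
    (hnat : NatActs K n f)
    (𝒜 : Finset (Set (Fin n → K))) (h𝒜 : 𝒜 = A.image (zeroSet K n))
    (μ : Set (Fin n → K) → ℤ) (hμ : IsMobius K n Set.univ 𝒜 μ) :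
    ∀ m : ℚ, HasMult K n (H1 K n f) m →
      m = ((poin K n Set.univ 𝒜 μ).eval 1 : ℤ) - 1 := by

  intro m hm
  have hf0 : f ≠ 0 := hsf.ne_zero
  obtain ⟨ℓ, hA, hinj⟩ := exists_enumeration A
  have hfprod : f = ∏ i ∈ Finset.range A.card, ℓ i := by
    rw [hf]
    conv_lhs => rw [hA]
    exact Finset.prod_image hinj
  have hℓ : ∀ i < A.card, (ℓ i).totalDegree = 1 := fun i hi => hdeg _ (by
    rw [hA]
    exact Finset.mem_image_of_mem _ (Finset.mem_range.2 hi))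
  let lam : MvPolynomial (Fin n) K →ₐ[K] Localization.Away f :=
    IsScalarTower.toAlgHom K (MvPolynomial (Fin n) K) (Localization.Away f)
  have hlam : ActsNaturally lam := hnat
  have hpow : Submonoid.powers f ≤ nonZeroDivisors (MvPolynomial (Fin n) K) :=
    powers_le_nonZeroDivisors_of_noZeroDivisors hf0
  have hunit : ∀ y : Submonoid.powers f, IsUnit (toRat K n y) := fun y =>
    IsLocalization.map_units (FractionRing (MvPolynomial (Fin n) K))
      (⟨y, hpow y.2⟩ : nonZeroDivisors (MvPolynomial (Fin n) K))
  let χ : Localization.Away f →ₐ[K] FractionRing (MvPolynomial (Fin n) K) :=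
    IsLocalization.liftAlgHom (M := Submonoid.powers f) (f := toRat K n) hunit
  have key := eq_card_nbcSets_sub_one_of_hasMult (ℓ := ℓ) (r := A.card)
    (t := fun i => lam (∏ j ∈ (Finset.range A.card).erase i, ℓ j) *
      IsLocalization.Away.invSelf f)
    hlam (IsLocalization.injective (Localization.Away f) hpow) χ
    (AlgHom.ext fun p => by
      simp [χ, lam])
    (fun i hi => by
      rw [mul_right_comm, ← map_mul, Finset.prod_erase_mul _ _ (Finset.mem_range.2 hi), ← hfprod]
      exact IsLocalization.Away.mul_invSelf f)
    hℓ
    (fun y => by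
      obtain ⟨e, p, h⟩ := IsLocalization.Away.surj f y
      exact ⟨p, e, by rw [← hfprod]; exact h⟩)
    (Submodule.mkQ _) (Submodule.mkQ_surjective _)
    (fun x => by
      rw [← coe_span_range_of_actsNaturally hlam, SetLike.mem_coe, ← Submodule.ker_mkQ
        (Submodule.span (Weyl K n) (Set.range lam))]
      rfl) hm
  rw [key, eval_one_poin (ℓ := ℓ) (r := A.card)
    (fun i hi => (mem_restrictTotalDegree _ _ _).2 (hℓ i hi).le)
    (fun i hi => notMem_span_one_of_totalDegree (hℓ i hi)) 𝒜
    (by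
      rw [h𝒜]
      conv_lhs => rw [hA]
      rw [Finset.image_image]
      rfl) μ hμ]
  push_cast
  rfl
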